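/- arXiv:1408.7095 — 4 statements merged into one kernel-verified Lean document; each statement's English description precedes it below -/
import Mathlib

section
/- Let (R,m) be a Gorenstein local ring of Krull dimension at least two. Then an ideal I of R generated by a system of parameters can never be written as a product I = JK of two proper ideals J and K of R. -/
universe u

open IsLocalRing

open CategoryTheory in
/-- A Gorenstein local ring: a Noetherian local ring having finite injective dimension as a
module over itself, i.e. `Ext^i(M, R) = 0` for all modules `M` and all `i` larger than some `n`. -/
def IsGorensteinLocalRing (R : Type u) [CommRing R] : Prop :=
  IsNoetherianRing R ∧ IsLocalRing R ∧ ∃ n : ℕ, ∀ i : ℕ, n < i → ∀ M : ModuleCat.{u} R,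
    Subsingleton (((Ext R (ModuleCat.{u} R) i).obj (Opposite.op M)).obj (ModuleCat.of R R))

/-- A system of parameters of a Noetherian local ring of dimension `d`: `d` elements of the
maximal ideal generating an ideal primary for the maximal ideal. -/
def IsSystemOfParameters (R : Type*) [CommRing R] [IsLocalRing R] {d : ℕ} (x : Fin d → R) :
    Prop :=
  ringKrullDim R = (d : WithBot ℕ∞) ∧ (∀ i, x i ∈ maximalIdeal R) ∧
    ∃ n : ℕ, (maximalIdeal R) ^ n ≤ Ideal.span (Set.range x)

namespace ParameterIdeal

open CategoryTheory Abelian Pointwise RingTheory.Sequence IsSMulRegular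

/-- Vanishing of the derived-functor `Ext` implies vanishing of the derived-category `Ext`. -/
lemma subsingleton_ext_of_subsingleton_derivedExt {R : Type u} [CommRing R] {n : ℕ}
    (M Y : ModuleCat.{u} R)
    (h : Subsingleton (((_root_.Ext R (ModuleCat.{u} R) (n + 1)).obj (Opposite.op M)).obj Y)) :
    Subsingleton (Ext M Y (n + 1)) := by
  let P := projectiveResolution M
  have hz : Limits.IsZero ((P.complex.linearYonedaObj R Y).homology (n + 1)) :=
    (ModuleCat.isZero_iff_subsingleton.mpr h).of_iso (P.isoExt (n + 1) Y).symm
  rw [← HomologicalComplex.exactAt_iff_isZero_homology,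
    HomologicalComplex.exactAt_iff' _ n (n + 1) (n + 2) (by simp) (by simp),
    ShortComplex.moduleCat_exact_iff] at hz
  refine subsingleton_of_forall_eq 0 fun α ↦ ?_
  obtain ⟨f, hf, rfl⟩ := P.extMk_surjective α (n + 2) rfl
  rw [P.extMk_eq_zero_iff f (n + 2) rfl hf n rfl]
  exact hz f hf

variable {R : Type u} [CommRing R]

lemma subsingleton_ext_middle {S : ShortComplex (ModuleCat.{u} R)} (hS : S.ShortExact)
    (Y : ModuleCat.{u} R) {n : ℕ} (h₁ : Subsingleton (Ext S.X₁ Y n))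
    (h₃ : Subsingleton (Ext S.X₃ Y n)) : Subsingleton (Ext S.X₂ Y n) := by
  refine subsingleton_of_forall_eq 0 fun x ↦ ?_
  obtain ⟨y, rfl⟩ := Ext.contravariant_sequence_exact₂ hS Y x (Subsingleton.elim _ _)
  rw [Subsingleton.elim y 0, Ext.comp_zero]

lemma subsingleton_ext_left {S : ShortComplex (ModuleCat.{u} R)} (hS : S.ShortExact)
    (Y : ModuleCat.{u} R) {n : ℕ} (h₂ : Subsingleton (Ext S.X₂ Y n))
    (h₃ : Subsingleton (Ext S.X₃ Y (n + 1))) : Subsingleton (Ext S.X₁ Y n) := by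
  refine subsingleton_of_forall_eq 0 fun x ↦ ?_
  obtain ⟨y, rfl⟩ := Ext.contravariant_sequence_exact₁ hS Y x (add_comm 1 n)
    (Subsingleton.elim _ _)
  rw [Subsingleton.elim y 0, Ext.comp_zero]

lemma subsingleton_ext_right {S : ShortComplex (ModuleCat.{u} R)} (hS : S.ShortExact)
    (Y : ModuleCat.{u} R) {n : ℕ} (h₂ : Subsingleton (Ext S.X₂ Y n))
    (h₁ : ∀ i < n, Subsingleton (Ext S.X₁ Y i)) : Subsingleton (Ext S.X₃ Y n) := by
  refine subsingleton_of_forall_eq 0 fun x ↦ ?_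
  cases n with
  | zero =>
    have := hS.epi_g
    exact Ext.precomp_mk₀_injective_of_epi Y S.g (Subsingleton.elim _ _)
  | succ n =>
    obtain ⟨y, rfl⟩ := Ext.contravariant_sequence_exact₃ hS Y x (Subsingleton.elim _ _)
      (add_comm 1 n)
    have := h₁ n n.lt_succ_self
    rw [Subsingleton.elim y 0, Ext.comp_zero]

lemma subsingleton_ext_quotSMulTop {N M : ModuleCat.{u} R} {x : R} (hx : IsSMulRegular M x)
    {n : ℕ} (h : ∀ i < n + 1, Subsingleton (Ext N M i)) :
    ∀ i < n, Subsingleton (Ext N (ModuleCat.of R (QuotSMulTop x M)) i) := by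
  intro i hi
  have h₁ := h i (by omega)
  have h₂ := h (i + 1) (by omega)
  refine subsingleton_of_forall_eq 0 fun y ↦ ?_
  obtain ⟨z, hz⟩ := Ext.covariant_sequence_exact₃ N hx.smulShortComplex_shortExact y
    (n₁ := i + 1) rfl (h₂.elim _ _)
  rw [← hz, show z = 0 from h₁.elim _ _, Ext.zero_comp]
  rfl

lemma subsingleton_ext_of_linearEquiv {N N' : Type u} [AddCommGroup N] [Module R N]
    [AddCommGroup N'] [Module R N'] (e : N ≃ₗ[R] N') {Y : ModuleCat.{u} R} {n : ℕ}
    (h : Subsingleton (Ext (ModuleCat.of R N) Y n)) :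
    Subsingleton (Ext (ModuleCat.of R N') Y n) := by
  refine subsingleton_of_forall_eq 0 fun x ↦ ?_
  have : x = (Ext.mk₀ e.toModuleIso.inv).comp
      ((Ext.mk₀ e.toModuleIso.hom).comp x (zero_add n)) (zero_add n) := by
    rw [Ext.mk₀_comp_mk₀_assoc, Iso.inv_hom_id, Ext.mk₀_id_comp]
  rw [this, h.elim ((Ext.mk₀ e.toModuleIso.hom).comp x (zero_add n)) 0, Ext.comp_zero]

lemma subsingleton_ext_of_injective {L N : Type u} [AddCommGroup L] [Module R L] [Module.Finite R L]
    [AddCommGroup N] [Module R N] [Module.Finite R N] {f : L →ₗ[R] N} (hf : Function.Injective f)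
    {Y : ModuleCat.{u} R} {n : ℕ}
    (h : ∀ (N : Type u) [AddCommGroup N] [Module R N] [Module.Finite R N],
      Subsingleton (Ext (ModuleCat.of R N) Y (n + 1)))
    (hN : Subsingleton (Ext (ModuleCat.of R N) Y n)) : Subsingleton (Ext (ModuleCat.of R L) Y n) :=
  subsingleton_ext_left (ModuleCat.shortComplex_shortExact
      (ModuleCat.shortComplexOfCompEqZero f (LinearMap.range f).mkQ
        (LinearMap.range_mkQ_comp f)) (LinearMap.exact_map_mkQ_range f) hf
        (Submodule.mkQ_surjective _)) Y hN (h _)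

lemma ringKrullDim_quotient_le_zero {I : Ideal R}
    (h : ∀ p q : Ideal R, p.IsPrime → q.IsPrime → I ≤ p → I ≤ q → p = q) :
    ringKrullDim (R ⧸ I) ≤ 0 := by
  rw [ringKrullDim_quotient]
  have : Subsingleton (PrimeSpectrum.zeroLocus (I : Set R)) :=
    ⟨fun p q ↦ Subtype.ext (PrimeSpectrum.ext (h _ _ p.1.2 q.1.2 p.2 q.2))⟩
  exact Order.krullDim_nonpos_of_subsingleton

lemma ringKrullDim_quotient_add_one_le {p q : Ideal R} [hp : p.IsPrime] {y : R} (hpq : p ≤ q)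
    (hyq : y ∈ q) (hyp : y ∉ p) : ringKrullDim (R ⧸ q) + 1 ≤ ringKrullDim (R ⧸ p) := by
  have hy : Ideal.Quotient.mk p y ∈ nonZeroDivisors (R ⧸ p) :=
    mem_nonZeroDivisors_of_ne_zero (by rwa [ne_eq, Ideal.Quotient.eq_zero_iff_mem])
  refine le_trans ?_ (ringKrullDim_quotient_succ_le_of_nonZeroDivisor hy)
  gcongr
  refine ringKrullDim_le_of_surjective (Ideal.Quotient.lift _ (Ideal.Quotient.factor hpq) ?_) ?_
  · intro a ha
    obtain ⟨b, rfl⟩ := Ideal.mem_span_singleton'.mp ha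
    rw [map_mul, Ideal.Quotient.factor_mk, Ideal.Quotient.eq_zero_iff_mem.mpr hyq, mul_zero]
  · exact Ideal.Quotient.lift_surjective_of_surjective _ _ (Ideal.Quotient.factor_surjective hpq)

variable [IsLocalRing R]

/-- A nonzero map from the residue field is injective. -/
lemma injective_of_ne_zero_of_residueField {N : Type u} [AddCommGroup N] [Module R N]
    {f : (R ⧸ maximalIdeal R) →ₗ[R] N} (hf : f ≠ 0) : Function.Injective f := by
  have : IsSimpleModule R (R ⧸ maximalIdeal R) :=
    isSimpleModule_iff_isCoatom.mpr (maximalIdeal.isMaximal R).out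
  exact (LinearMap.injective_or_eq_zero f).resolve_right hf

lemma ofList_lt_top {rs : List R} (hrs : ∀ r ∈ rs, r ∈ maximalIdeal R) :
    Ideal.ofList rs < ⊤ :=
  lt_of_le_of_lt (Ideal.span_le.mpr hrs) (lt_top_iff_ne_top.mpr (maximalIdeal.isMaximal R).ne_top)

/-- If `J * K` is principal modulo `L`, generated by a regular element, then `K` is principal
modulo `L`. -/
lemma exists_le_sup_span_singleton_of_mul_eq {L J K : Ideal R} {x : R} (hL : L ≠ ⊤)
    (hx : IsSMulRegular (R ⧸ L) x) (hJK : J * K = L ⊔ Ideal.span {x}) :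
    ∃ k ∈ K, K ≤ L ⊔ Ideal.span {k} := by
  rw [isSMulRegular_quotient_iff_mem_of_smul_mem] at hx
  have hmem : ∀ j ∈ J, ∀ k ∈ K, ∃ c, j * k - x * c ∈ L := by
    intro j hj k hk
    have := hJK ▸ Ideal.mul_mem_mul hj hk
    obtain ⟨l, hl, y, hy, hly⟩ := Submodule.mem_sup.mp this
    obtain ⟨c, rfl⟩ := Ideal.mem_span_singleton.mp hy
    exact ⟨c, by rwa [← hly, add_sub_cancel_right]⟩
  obtain ⟨j, hj, k, hk, hjk⟩ : ∃ j ∈ J, ∃ k ∈ K, j * k ∉ L ⊔ Ideal.span {x} * maximalIdeal R := by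
    by_contra! H
    have hxm : x ∈ L ⊔ Ideal.span {x} * maximalIdeal R :=
      Ideal.mul_le.mpr H (hJK ▸ Ideal.mem_sup_right (Ideal.mem_span_singleton_self x))
    obtain ⟨l, hl, y, hy, hly⟩ := Submodule.mem_sup.mp hxm
    obtain ⟨c, hc, rfl⟩ := Ideal.mem_span_singleton_mul.mp hy
    have h1 : x • (1 - c) ∈ L := by
      have : x • (1 - c) = l := by rw [smul_eq_mul]; linear_combination -hly
      rwa [this]
    exact hL (Ideal.eq_top_of_isUnit_mem _ (hx _ h1) (isUnit_one_sub_self_of_mem_nonunits c hc))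
  obtain ⟨c, hc⟩ := hmem j hj k hk
  have hcu : IsUnit c := by
    by_contra hcm
    refine hjk ?_
    rw [← sub_add_cancel (j * k) (x * c)]
    exact Submodule.add_mem_sup hc (Ideal.mul_mem_mul (Ideal.mem_span_singleton_self x) hcm)
  obtain ⟨u, hu⟩ := hcu.exists_left_inv
  have hjreg : ∀ a, j * a ∈ L → a ∈ L := by
    intro a ha
    have h1 : x • (c * a) ∈ L := by
      have : x • (c * a) = k * (j * a) - a * (j * k - x * c) := by rw [smul_eq_mul]; ring
      rw [this]
      exact L.sub_mem (L.mul_mem_left _ ha) (L.mul_mem_left _ hc)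
    have h2 := L.mul_mem_left u (hx _ h1)
    rwa [← mul_assoc, hu, one_mul] at h2
  refine ⟨k, hk, fun y hy ↦ ?_⟩
  obtain ⟨c', hc'⟩ := hmem j hj y hy
  rw [← sub_add_cancel y (u * c' * k)]
  refine Submodule.add_mem_sup (hjreg _ ?_)
    (Ideal.mul_mem_left _ _ (Ideal.mem_span_singleton_self k))
  have : j * (y - u * c' * k) = (j * y - x * c') - u * c' * (j * k - x * c) := by
    linear_combination (- x * c') * hu
  rw [this]
  exact L.sub_mem hc' (L.mul_mem_left _ hc)

variable [IsNoetherianRing R]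

lemma subsingleton_ext_of_smul {N Y : ModuleCat.{u} R} [Module.Finite R N] [Module.Finite R Y]
    {a : R} (ha : IsSMulRegular N a) (ham : a ∈ maximalIdeal R) {n : ℕ}
    (h : Subsingleton (Ext (ModuleCat.of R (QuotSMulTop a N)) Y (n + 1))) :
    Subsingleton (Ext N Y n) := by
  have hS := ha.smulShortComplex_shortExact
  by_contra! ntr
  have : a ∈ (Module.annihilator R (Ext N Y n)).jacobson :=
    (IsLocalRing.maximalIdeal_le_jacobson _) ham
  absurd Submodule.top_ne_pointwise_smul_of_mem_jacobson_annihilator this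
  rw [eq_comm, eq_top_iff]
  intro y _
  obtain ⟨(z : Ext N Y n), hz⟩ := Ext.contravariant_sequence_exact₁ hS Y y (add_comm 1 n)
    (h.elim _ _)
  have key : (Ext.mk₀ (a • 𝟙 N)).comp z (zero_add n) = a • z := by
    rw [Ext.mk₀_smul, Ext.smul_comp, Ext.mk₀_id_comp]
  have hy : a • z = y := key.symm.trans hz
  rw [← hy]
  exact Submodule.smul_mem_pointwise_smul _ _ ⊤ trivial

/-- If `Ext^(n+1)(-, Y)` vanishes on finite modules and `Ext^n(k, Y) = 0` for the residue field
`k`, then `Ext^n(-, Y)` vanishes on finite modules. -/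
lemma subsingleton_ext_of_subsingleton_ext_residueField {Y : ModuleCat.{u} R} [Module.Finite R Y]
    {n : ℕ}
    (h : ∀ (N : Type u) [AddCommGroup N] [Module R N] [Module.Finite R N],
      Subsingleton (Ext (ModuleCat.of R N) Y (n + 1)))
    (hk : Subsingleton (Ext (ModuleCat.of R (R ⧸ maximalIdeal R)) Y n))
    (N : Type u) [AddCommGroup N] [Module R N] [hN : Module.Finite R N] :
    Subsingleton (Ext (ModuleCat.of R N) Y n) := by
  induction hN using IsNoetherianRing.induction_on_isQuotientEquivQuotientPrime R with
  | subsingleton N =>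
    refine subsingleton_of_forall_eq 0 fun x ↦ ?_
    rw [← Ext.mk₀_id_comp x,
      (ModuleCat.isZero_of_subsingleton (ModuleCat.of R N)).eq_of_src (𝟙 _) 0, Ext.mk₀_zero,
      Ext.zero_comp]
  | quotient N p e =>
    by_cases hp : p.asIdeal = maximalIdeal R
    · rw [hp] at e
      exact subsingleton_ext_of_linearEquiv e.symm hk
    · have hlt : p.asIdeal < maximalIdeal R :=
        lt_of_le_of_ne (le_maximalIdeal p.2.ne_top) hp
      obtain ⟨a, ham, hap⟩ := SetLike.exists_of_lt hlt
      refine subsingleton_ext_of_smul (a := a) ?_ ham (h _)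
      rw [e.isSMulRegular_congr, isSMulRegular_quotient_iff_mem_of_smul_mem]
      exact fun x hx ↦ (p.2.mem_or_mem hx).resolve_left hap
  | exact N₁ N₂ N₃ f g hf hg hfg h₁ h₃ =>
    refine subsingleton_ext_middle (ModuleCat.shortComplex_shortExact
      (ModuleCat.shortComplexOfCompEqZero f g hfg.linearMap_comp_eq_zero) hfg hf hg) Y h₁ h₃

/-- If `rs` is a regular sequence with `Ext^(length rs)(k, R) ≠ 0`, then the residue field `k`
embeds in `R ⧸ (rs)`. -/
lemma exists_injective_residueField_quotient {rs : List R} (hreg : IsRegular R rs)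
    (hrs : ∀ r ∈ rs, r ∈ maximalIdeal R)
    (hk : ¬ Subsingleton (Ext (ModuleCat.of R (R ⧸ maximalIdeal R)) (ModuleCat.of R R) rs.length)) :
    ∃ f : (R ⧸ maximalIdeal R) →ₗ[R] R ⧸ Ideal.ofList rs, Function.Injective f := by
  by_contra! hf
  have : Subsingleton ((R ⧸ maximalIdeal R) →ₗ[R] R ⧸ Ideal.ofList rs) :=
    subsingleton_of_forall_eq 0 fun f ↦
      by_contra fun h ↦ hf f (injective_of_ne_zero_of_residueField h)
  obtain ⟨r, hr, hreg'⟩ := IsSMulRegular.subsingleton_linearMap_iff.mp this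
  rw [Ideal.annihilator_quotient] at hr
  have hmem : ∀ s ∈ rs ++ [r], s ∈ maximalIdeal R := by
    intro s hs
    obtain hs | rfl := by simpa using hs
    exacts [hrs s hs, hr]
  have hw : IsRegular R (rs ++ [r]) := by
    refine ⟨(isWeaklyRegular_append_iff _ _ _).mpr ⟨hreg.1, ?_⟩, ?_⟩
    · rw [isWeaklyRegular_singleton_iff]
      have e : Ideal.ofList rs • (⊤ : Submodule R R) = Ideal.ofList rs := by
        rw [smul_eq_mul, Ideal.mul_top]
      rwa [e]
    · rw [smul_eq_mul, Ideal.mul_top]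
      exact (ofList_lt_top hmem).ne'
  refine hk (ModuleCat.subsingleton_ext_of_exists_isRegular (maximalIdeal R) _ ?_ _ ?_ _ hmem hw
    _ ?_)
  · change Module.support R (R ⧸ maximalIdeal R) ⊆ _
    rw [Module.support_eq_zeroLocus, Ideal.annihilator_quotient]
  · change maximalIdeal R • (⊤ : Submodule R R) < ⊤
    rw [smul_eq_mul, Ideal.mul_top]
    exact lt_top_iff_ne_top.mpr (maximalIdeal.isMaximal R).ne_top
  · simp

lemma subsingleton_ext_quotient_ofList {rs : List R} (hreg : IsRegular R rs) (Y : ModuleCat.{u} R)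
    {j : ℕ} (hj : rs.length < j) :
    Subsingleton (Ext (ModuleCat.of R (R ⧸ Ideal.ofList rs)) Y j) := by
  refine subsingleton_ext_of_linearEquiv (Shrink.linearEquiv.{u} R (R ⧸ Ideal.ofList rs)) ?_
  have : HasProjectiveDimensionLT
      (ModuleCat.of R (Shrink.{u} (R ⧸ Ideal.ofList rs))) (rs.length + 1) := by
    rw [← projectiveDimension_lt_iff, ModuleCat.projectiveDimension_quotient_eq_length rs hreg]
    exact_mod_cast rs.length.lt_succ_self
  exact HasProjectiveDimensionLT.subsingleton _ (rs.length + 1) _ hj Y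

/-- If `R` has finite injective dimension over itself, then `Ext^t(k, R) = 0` for all
`t < dim R`. -/
lemma subsingleton_ext_residueField_of_lt {d : ℕ} (hd : ringKrullDim R = d)
    (hfin : ∃ n : ℕ, ∀ i : ℕ, n < i → ∀ (N : Type u) [AddCommGroup N] [Module R N],
      Subsingleton (Ext (ModuleCat.of R N) (ModuleCat.of R R) i)) {t : ℕ} (ht : t < d) :
    Subsingleton (Ext (ModuleCat.of R (R ⧸ maximalIdeal R)) (ModuleCat.of R R) t) := by
  induction t using Nat.strong_induction_on with
  | _ t ih =>
  by_contra hk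
  have hsupp : Module.support R (R ⧸ maximalIdeal R) =
      PrimeSpectrum.zeroLocus (maximalIdeal R) := by
    rw [Module.support_eq_zeroLocus, Ideal.annihilator_quotient]
  obtain ⟨rs, rfl, hrs, hreg⟩ := ModuleCat.exists_isRegular_of_exists_subsingleton_ext
    (maximalIdeal R) t (ModuleCat.of R R) (by
      change maximalIdeal R • (⊤ : Submodule R R) < ⊤
      rw [smul_eq_mul, Ideal.mul_top]
      exact lt_top_iff_ne_top.mpr (maximalIdeal.isMaximal R).ne_top)
    (ModuleCat.of R (R ⧸ maximalIdeal R)) hsupp (fun i hi ↦ ih i hi (hi.trans ht))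
  obtain ⟨f, hf⟩ := exists_injective_residueField_quotient hreg hrs hk
  have hvan : ∀ j, rs.length < j → ∀ (N : Type u) [AddCommGroup N] [Module R N] [Module.Finite R N],
      Subsingleton (Ext (ModuleCat.of R N) (ModuleCat.of R R) j) := by
    obtain ⟨n, hn⟩ := hfin
    intro j hj
    by_cases hnj : n < j
    · exact fun N ↦ hn j hnj N
    refine Nat.decreasingInduction' (n := n + 1) (m := j)
      (P := fun j ↦ ∀ (N : Type u) [AddCommGroup N] [Module R N] [Module.Finite R N],
      Subsingleton (Ext (ModuleCat.of R N) (ModuleCat.of R R) j)) ?_ (by omega)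
      (fun N ↦ hn _ n.lt_succ_self N)
    intro l _ hjl h
    exact subsingleton_ext_of_subsingleton_ext_residueField h (subsingleton_ext_of_injective hf h
      (subsingleton_ext_quotient_ofList hreg _ (hj.trans_le hjl)))
  obtain ⟨p, hp, hp', hpm⟩ : ∃ p : Ideal R,
      p.IsPrime ∧ Ideal.ofList rs ≤ p ∧ p ≠ maximalIdeal R := by
    by_contra! H
    have h2 := ringKrullDim_add_length_eq_ringKrullDim_of_isRegular rs hreg
    have h3 := ringKrullDim_quotient_le_zero
      fun p q hp hq hp' hq' ↦ (H p hp hp').trans (H q hq hq').symm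
    have h4 : (d : WithBot ℕ∞) ≤ 0 + rs.length := by
      rw [← hd, ← h2]
      gcongr
    rw [zero_add] at h4
    exact absurd (by exact_mod_cast h4) (not_le.mpr ht)
  obtain ⟨a, ham, hap⟩ := SetLike.exists_of_lt (lt_of_le_of_ne (le_maximalIdeal hp.ne_top) hpm)
  have h1 : Subsingleton (Ext (ModuleCat.of R (R ⧸ p)) (ModuleCat.of R R) rs.length) := by
    refine subsingleton_ext_of_smul (a := a) ?_ ham (hvan _ (Nat.lt_succ_self _) _)
    rw [isSMulRegular_quotient_iff_mem_of_smul_mem]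
    exact fun x hx ↦ (hp.mem_or_mem hx).resolve_left hap
  refine hk ?_
  have hle : p ≤ maximalIdeal R := le_maximalIdeal hp.ne_top
  refine subsingleton_ext_right (LinearMap.shortExact_shortComplexKer
    (f := Submodule.factor hle) (Submodule.factor_surjective hle)) _ h1 ?_
  refine ModuleCat.subsingleton_ext_of_exists_isRegular (Ideal.ofList rs) _ ?_ _ ?_ _
    (fun r hr ↦ Ideal.subset_span hr) hreg
  · refine (Module.support_subset_of_injective (LinearMap.ker (Submodule.factor hle)).subtype
      Subtype.val_injective).trans ?_
    rw [Module.support_eq_zeroLocus, Ideal.annihilator_quotient]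
    exact PrimeSpectrum.zeroLocus_anti_mono hp'
  · change Ideal.ofList rs • (⊤ : Submodule R R) < ⊤
    rw [smul_eq_mul, Ideal.mul_top]
    exact ofList_lt_top hrs

lemma ringKrullDim_quotient_le_length {I : Ideal R} {xs : List R}
    (hxs : ∀ r ∈ xs, r ∈ maximalIdeal R)
    (h : ∀ p : Ideal R, p.IsPrime → I ≤ p → Ideal.ofList xs ≤ p → p = maximalIdeal R) :
    ringKrullDim (R ⧸ I) ≤ xs.length := by
  classical
  cases subsingleton_or_nontrivial (R ⧸ I)
  · rw [ringKrullDim_eq_bot_of_subsingleton]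
    exact bot_le
  have := IsLocalRing.of_surjective' (Ideal.Quotient.mk I) Ideal.Quotient.mk_surjective
  have hmk : IsLocalHom (Ideal.Quotient.mk I) :=
    .of_surjective _ Ideal.Quotient.mk_surjective
  set s : Finset (R ⧸ I) := (xs.map (Ideal.Quotient.mk I)).toFinset with hs
  refine (ringKrullDim_le_ringKrullDim_quotient_add_card s ?_).trans ?_
  · intro y hy
    obtain ⟨r, hr, rfl⟩ : ∃ r ∈ xs, Ideal.Quotient.mk I r = y := by simpa [hs] using hy
    rw [SetLike.mem_coe, IsLocalRing.ringJacobson_eq_maximalIdeal]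
    exact fun hu ↦ hxs r hr (hmk.map_nonunit r hu)
  · have hcomap : ∀ P : Ideal (R ⧸ I), P.IsPrime → Ideal.span (s : Set (R ⧸ I)) ≤ P →
        P.comap (Ideal.Quotient.mk I) = maximalIdeal R := by
      intro P hP hsP
      refine h _ inferInstance ?_ (Ideal.span_le.mpr fun r hr ↦ hsP (Ideal.subset_span ?_))
      · conv_lhs => rw [← Ideal.mk_ker (I := I)]
        exact Ideal.comap_mono bot_le
      · have : r ∈ xs := hr
        simp only [hs, List.coe_toFinset, Set.mem_ofPred_eq]
        exact List.mem_map_of_mem this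
    have h0 : ringKrullDim ((R ⧸ I) ⧸ Ideal.span (s : Set (R ⧸ I))) ≤ 0 :=
      ringKrullDim_quotient_le_zero fun P Q hP hQ hP' hQ' ↦
        Ideal.comap_injective_of_surjective _ Ideal.Quotient.mk_surjective
          ((hcomap P hP hP').trans (hcomap Q hQ hQ').symm)
    have h1 : s.card ≤ xs.length := (List.toFinset_card_le _).trans (by simp)
    calc _ ≤ (0 : WithBot ℕ∞) + (s.card : WithBot ℕ∞) := by gcongr
      _ ≤ xs.length := by rw [zero_add]; exact_mod_cast h1

/-- The depth of `M` is at most `dim R ⧸ p` for every associated prime `p` of `M`. -/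
lemma le_ringKrullDim_quotient_of_isAssociatedPrime {t : ℕ} {M : Type u} [AddCommGroup M]
    [Module R M] [Module.Finite R M]
    (h : ∀ i < t, Subsingleton (Ext (ModuleCat.of R (R ⧸ maximalIdeal R)) (ModuleCat.of R M) i))
    {p : Ideal R} (hp : IsAssociatedPrime p M) : (t : WithBot ℕ∞) ≤ ringKrullDim (R ⧸ p) := by
  induction t generalizing M p with
  | zero =>
    have := Ideal.Quotient.nontrivial_iff.mpr hp.isPrime.ne_top
    exact ringKrullDim_nonneg_of_nontrivial
  | succ t ih =>
    have := (Ext.addEquiv₀.trans ModuleCat.homAddEquiv).symm.subsingleton_congr.mpr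
      (h 0 t.succ_pos)
    obtain ⟨y, hym, (hy : IsSMulRegular M y)⟩ := IsSMulRegular.subsingleton_linearMap_iff.mp this
    rw [Ideal.annihilator_quotient] at hym
    obtain ⟨hpp, x, hx⟩ := isAssociatedPrime_iff.mp hp
    have hpx : ∀ a, a ∈ p ↔ a • x = 0 := fun a ↦ by rw [hx]; simp [Submodule.mem_colon_singleton]
    have hx0 : x ≠ 0 := by
      rintro rfl
      exact hpp.ne_top ((Ideal.eq_top_iff_one p).mpr ((hpx 1).mpr (smul_zero _)))
    have hyp : y ∉ p := fun hyp ↦ hx0 (hy.right_eq_zero_of_smul ((hpx y).mp hyp))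
    obtain ⟨z, hz, hzy⟩ : ∃ z ∈ Submodule.torsionBySet R M p, z ∉ y • (⊤ : Submodule R M) := by
      by_contra! H
      have hN : Submodule.torsionBySet R M p = ⊥ := by
        refine Submodule.eq_bot_of_le_smul_of_le_jacobson_bot (maximalIdeal R) _
          (IsNoetherian.noetherian _) (fun z hz ↦ ?_) (maximalIdeal_le_jacobson _)
        obtain ⟨w, -, rfl⟩ := H z hz
        refine Submodule.smul_mem_smul hym ?_
        rw [Submodule.mem_torsionBySet_iff] at hz ⊢
        intro a
        refine hy.right_eq_zero_of_smul ?_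
        rw [smul_comm]
        exact hz a
      have : x ∈ Submodule.torsionBySet R M p :=
        (Submodule.mem_torsionBySet_iff _ _).mpr fun a ↦ (hpx a).mp a.2
      rw [hN] at this
      exact hx0 this
    have hz0 : (Submodule.Quotient.mk z : QuotSMulTop y M) ≠ 0 := by
      rwa [ne_eq, Submodule.Quotient.mk_eq_zero]
    obtain ⟨q, hq, hzq⟩ := exists_le_isAssociatedPrime_of_isNoetherianRing R _ hz0
    have hzq' : ∀ a : R, a • z ∈ y • (⊤ : Submodule R M) → a ∈ q := fun a ha ↦ hzq (by
      rw [Submodule.mem_colon_singleton, ← Submodule.Quotient.mk_smul]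
      exact (Submodule.Quotient.mk_eq_zero _).mpr ha)
    have hpq : p ≤ q := fun a ha ↦ hzq' a (by
      rw [(Submodule.mem_torsionBySet_iff _ _).mp hz ⟨a, ha⟩]
      exact Submodule.zero_mem _)
    have hyq : y ∈ q := hzq' y (Submodule.smul_mem_pointwise_smul _ _ _ trivial)
    refine le_trans ?_ (ringKrullDim_quotient_add_one_le hpq hyq hyp)
    push_cast
    gcongr
    exact ih (subsingleton_ext_quotSMulTop (M := ModuleCat.of R M) hy h) hq

/-- A system generating an ideal primary to the maximal ideal modulo the annihilator of `M`, with at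
most `depth M` elements, is `M`-regular. -/
lemma isWeaklyRegular_of_subsingleton_ext {xs : List R} (hxs : ∀ r ∈ xs, r ∈ maximalIdeal R)
    {M : Type u} [AddCommGroup M] [Module R M] [Module.Finite R M]
    (hprime : ∀ p : Ideal R, p.IsPrime → Module.annihilator R M ≤ p → Ideal.ofList xs ≤ p →
      p = maximalIdeal R)
    (h : ∀ i < xs.length,
      Subsingleton (Ext (ModuleCat.of R (R ⧸ maximalIdeal R)) (ModuleCat.of R M) i)) :
    IsWeaklyRegular M xs := by
  induction xs generalizing M with
  | nil => exact .nil R M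
  | cons x xs ih =>
    have hxs' : ∀ r ∈ xs, r ∈ maximalIdeal R := fun r hr ↦ hxs r (List.mem_cons_of_mem _ hr)
    have hx : IsSMulRegular M x := by
      rw [isSMulRegular_iff_right_eq_zero_of_smul]
      by_contra! hz
      obtain ⟨z, hz, hz0⟩ := hz
      have hmem : x ∈ ⋃ p ∈ associatedPrimes R M, (p : Set R) := by
        rw [biUnion_associatedPrimes_eq_zero_divisors]
        exact ⟨z, hz0, hz⟩
      obtain ⟨p, hp, hxp⟩ := Set.mem_iUnion₂.mp hmem
      have h1 := le_ringKrullDim_quotient_of_isAssociatedPrime h hp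
      have h2 := h1.trans (ringKrullDim_quotient_le_length hxs' fun q hq hpq hxq ↦
        hprime q hq (Submodule.annihilator_top.symm.trans_le (hp.annihilator_le.trans hpq)) (by
          rw [Ideal.ofList_cons]
          exact sup_le ((Ideal.span_singleton_le_iff_mem _).mpr (hpq hxp)) hxq))
      have h3 : xs.length + 1 ≤ xs.length := by exact_mod_cast h2
      omega
    refine (isWeaklyRegular_cons_iff _ _ _).mpr ⟨hx, ih hxs' ?_
      (subsingleton_ext_quotSMulTop (M := ModuleCat.of R M) hx h)⟩
    intro q hq hMq hxq
    refine hprime q hq (le_trans ?_ hMq) ?_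
    · exact LinearMap.annihilator_le_of_surjective _ (Submodule.mkQ_surjective _)
    · rw [Ideal.ofList_cons]
      refine sup_le ((Ideal.span_singleton_le_iff_mem _).mpr (hMq ?_)) hxq
      rw [Module.mem_annihilator]
      intro v
      obtain ⟨v, rfl⟩ := Submodule.mkQ_surjective _ v
      rw [← map_smul]
      exact (Submodule.Quotient.mk_eq_zero _).mpr (Submodule.smul_mem_pointwise_smul _ _ _ trivial)

lemma ringKrullDim_le_one_of_pow_le_span_singleton {n : ℕ} {k : R} (hk : k ∈ maximalIdeal R)
    (h : maximalIdeal R ^ n ≤ Ideal.span {k}) : ringKrullDim R ≤ 1 := by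
  have hmin : maximalIdeal R ∈ (Ideal.span {k}).minimalPrimes :=
    ⟨⟨inferInstance, (Ideal.span_singleton_le_iff_mem _).mpr hk⟩,
      fun q hq _ ↦ hq.1.le_of_pow_le (h.trans hq.2)⟩
  rw [← maximalIdeal_height_eq_ringKrullDim]
  exact_mod_cast Ideal.height_le_one_of_isPrincipal_of_mem_minimalPrimes _ _ hmin

/-- Systems of parameters are regular sequences when `R` has finite injective dimension. -/
lemma isWeaklyRegular_of_finite_injectiveDimension {xs : List R}
    (hxs : ∀ r ∈ xs, r ∈ maximalIdeal R) (hd : ringKrullDim R = xs.length)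
    {n : ℕ} (hn : maximalIdeal R ^ n ≤ Ideal.ofList xs)
    (hfin : ∃ n : ℕ, ∀ i : ℕ, n < i → ∀ (N : Type u) [AddCommGroup N] [Module R N],
      Subsingleton (Ext (ModuleCat.of R N) (ModuleCat.of R R) i)) :
    IsWeaklyRegular R xs :=
  isWeaklyRegular_of_subsingleton_ext hxs
    (fun _ hp _ hxp ↦ le_antisymm (le_maximalIdeal hp.ne_top) (hp.le_of_pow_le (hn.trans hxp)))
    fun _ hi ↦ subsingleton_ext_residueField_of_lt hd hfin hi

end ParameterIdeal

/-- (Heinzer–Lantz–Shah) In a Gorenstein local ring of dimension at least two, an ideal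
generated by a system of parameters is never the product of two proper ideals. -/
theorem parameter_ideal_not_product_of_gorenstein
    (R : Type u) [CommRing R] [IsLocalRing R]
    (hgor : IsGorensteinLocalRing R) (hdim : 2 ≤ ringKrullDim R)
    {d : ℕ} (x : Fin d → R) (hx : IsSystemOfParameters R x)
    (I : Ideal R) (hI : I = Ideal.span (Set.range x)) :
    ¬ ∃ J K : Ideal R, J ≠ ⊤ ∧ K ≠ ⊤ ∧ I = J * K := by
  rintro ⟨J, K, hJ, hK, hIJK⟩
  obtain ⟨hnoeth, -, n, hn⟩ := hgor
  obtain ⟨hd, hxm, m, hm⟩ := hx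
  cases d with
  | zero =>
    rw [hd] at hdim
    exact absurd hdim (by norm_num)
  | succ e =>
  have hofList : Ideal.ofList (List.ofFn x) = I := by
    rw [hI, Ideal.ofList]
    congr 1
    ext r
    exact List.mem_ofFn' x r
  have hreg : RingTheory.Sequence.IsWeaklyRegular R (List.ofFn x) := by
    refine ParameterIdeal.isWeaklyRegular_of_finite_injectiveDimension
      (List.forall_mem_ofFn_iff.mpr hxm) (by rw [List.length_ofFn, hd])
      (hm.trans_eq (hI.symm.trans hofList.symm)) ⟨n, fun i hi N _ _ ↦ ?_⟩
    obtain ⟨i, rfl⟩ := Nat.exists_eq_succ_of_ne_zero (Nat.ne_zero_of_lt hi)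
    exact ParameterIdeal.subsingleton_ext_of_subsingleton_derivedExt _ _ (hn _ hi _)
  rw [List.ofFn_succ_last] at hreg hofList
  rw [RingTheory.Sequence.isWeaklyRegular_append_iff,
    RingTheory.Sequence.isWeaklyRegular_singleton_iff, smul_eq_mul, Ideal.mul_top] at hreg
  rw [Ideal.ofList_append, Ideal.ofList_singleton] at hofList
  set L := Ideal.ofList (List.ofFn fun i : Fin e ↦ x i.castSucc)
  have hL : L ≤ I := le_sup_left.trans_eq hofList
  have hIm : I ≤ J := hIJK.trans_le Ideal.mul_le_left
  obtain ⟨k, hk, hKk⟩ := ParameterIdeal.exists_le_sup_span_singleton_of_mul_eq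
    (fun h ↦ hJ (top_le_iff.mp (h ▸ hL.trans hIm))) hreg.2 (hIJK.symm.trans hofList.symm)
  have hIk : I ≤ Ideal.span {k} := by
    refine Submodule.le_of_le_smul_of_le_jacobson_bot (I := J) (IsNoetherian.noetherian I)
      ((le_maximalIdeal hJ).trans (maximalIdeal_le_jacobson _)) ?_
    calc I = J * K := hIJK
      _ ≤ J * (I ⊔ Ideal.span {k}) := Ideal.mul_mono_right (hKk.trans (sup_le_sup_right hL _))
      _ = J * Ideal.span {k} ⊔ J * I := by rw [Ideal.mul_sup, sup_comm]
      _ ≤ Ideal.span {k} ⊔ J • I := sup_le_sup_right Ideal.mul_le_right _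
  have hle := ParameterIdeal.ringKrullDim_le_one_of_pow_le_span_singleton
    (le_maximalIdeal hK hk) (hm.trans (hI.symm.trans_le hIk))
  exact absurd (hdim.trans hle) (by norm_num)
end

section
/- Let (S,m) be a Noetherian local ring, and let J and K be proper ideals such that the ideal I = JK is m-primary, I : K = J, I : J = K, and R = S/I is an Artinian Gorenstein local ring. Then length_S(S/(J+K)) = length_S((J ∩ K)/JK). -/
universe u

open IsLocalRing

/-- An Artinian local ring is Gorenstein iff its socle `(0 : m)` is a one-dimensional vector
space over the residue field, i.e. a simple module. -/
def IsArtinianGorensteinLocalRing (R : Type*) [CommRing R] : Prop :=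
  IsArtinianRing R ∧ ∃ _h : IsLocalRing R,
    IsSimpleModule R ↥((⊥ : Ideal R).colon (maximalIdeal R))

/-- The length of a module: the supremum of lengths of chains of submodules ending at `⊤`. -/
noncomputable def moduleLength (R M : Type*) [Ring R] [AddCommGroup M] [Module R M] : ℕ∞ :=
  Order.height (⊤ : Submodule R M)

theorem antitone_of_covBy_le {α β : Type*} [PartialOrder α] [WellFoundedGT α]
    [IsStronglyAtomic α] [Preorder β] {f : α → β} (hf : ∀ a b, a ⋖ b → f b ≤ f a) :
    Antitone f := by
  intro a
  induction a using WellFoundedGT.induction with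
  | ind a ih =>
    intro b hab
    obtain rfl | hlt := hab.eq_or_lt
    · exact le_rfl
    · obtain ⟨c, hac, hcb⟩ := exists_covBy_le_of_lt hlt
      exact (ih c hac.lt hcb).trans (hf a c hac)

section Length

variable {R M : Type*} [Ring R] [AddCommGroup M] [Module R M] {X Y : Submodule R M}

theorem length_quotient_eq_add (h : X ≤ Y) :
    Module.length R (M ⧸ X) =
      Module.length R (M ⧸ Y) + Module.length R (Y ⧸ X.comap Y.subtype) := by
  rw [add_comm]
  refine Module.length_eq_add_of_exact ((X.comap Y.subtype).mapQ X Y.subtype le_rfl)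
    (Submodule.factor h) ?_ (Submodule.factor_surjective h) ?_
  · rw [← LinearMap.ker_eq_bot, Submodule.ker_mapQ, Submodule.mkQ_map_self]
  · rw [LinearMap.exact_iff, Submodule.factor, Submodule.ker_mapQ, Submodule.range_mapQ,
      Submodule.range_subtype, Submodule.comap_id]

theorem length_quotient_of_covBy (h : X ⋖ Y) :
    Module.length R (M ⧸ X) = Module.length R (M ⧸ Y) + 1 := by
  have := (covBy_iff_quot_is_simple h.le).1 h
  rw [length_quotient_eq_add h.le, Module.length_eq_one R (Y ⧸ X.comap Y.subtype)]

theorem length_quotient_le_of_wcovBy (h : X ⩿ Y) :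
    Module.length R (M ⧸ X) ≤ Module.length R (M ⧸ Y) + 1 := by
  obtain h | rfl := h.covBy_or_eq
  · exact (length_quotient_of_covBy h).le
  · exact le_self_add

end Length

theorem colon_sup {R : Type*} [CommRing R] (I J K : Ideal R) :
    I.colon (J ⊔ K : Ideal R) = I.colon J ⊓ I.colon K := by
  rw [← Submodule.colon_union, ← Submodule.colon_span (S := (J ∪ K : Set R)), Submodule.span_union,
    Submodule.span_eq, Submodule.span_eq]

theorem sup_span_singleton_eq_of_covBy {R : Type*} [CommRing R] {A B : Ideal R} (h : A ⋖ B) {b : R}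
    (hbB : b ∈ B) (hbA : b ∉ A) : A ⊔ Ideal.span {b} = B := by
  refine (h.eq_or_eq le_sup_left (sup_le h.le ?_)).resolve_left fun hA => hbA ?_
  · exact (Ideal.span_singleton_le_iff_mem _).2 hbB
  · exact hA ▸ Ideal.mem_sup_right (Ideal.mem_span_singleton_self _)

section Local

variable {S : Type*} [CommRing S] [IsLocalRing S] {I : Ideal S}

theorem exists_sub_mul_mem_of_isSimpleModule_socle (I : Ideal S) [IsLocalRing (S ⧸ I)]
    [IsSimpleModule (S ⧸ I) ↥((⊥ : Ideal (S ⧸ I)).colon (maximalIdeal (S ⧸ I)))]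
    {x y : S} (hx : ∀ s ∈ maximalIdeal S, s * x ∈ I) (hy : ∀ s ∈ maximalIdeal S, s * y ∈ I)
    (hyI : y ∉ I) : ∃ s, x - s * y ∈ I := by
  have hsocle {z : S} (hz : ∀ s ∈ maximalIdeal S, s * z ∈ I) :
      Ideal.Quotient.mk I z ∈ (⊥ : Ideal (S ⧸ I)).colon (maximalIdeal (S ⧸ I)) := by
    refine Submodule.mem_colon.2 fun r hr => ?_
    obtain ⟨s, rfl⟩ := Ideal.Quotient.mk_surjective r
    have hs : s ∈ maximalIdeal S := fun hu => hr (hu.map _)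
    rw [smul_eq_mul, ← map_mul, Ideal.mem_bot, Ideal.Quotient.eq_zero_iff_mem, mul_comm]
    exact hz s hs
  obtain ⟨r, hr⟩ := (IsSimpleModule.toSpanSingleton_surjective (S ⧸ I)
    (m := (⟨_, hsocle hy⟩ : ↥((⊥ : Ideal (S ⧸ I)).colon (maximalIdeal (S ⧸ I)))))
    (fun h => hyI (Ideal.Quotient.eq_zero_iff_mem.1 (congrArg Subtype.val h)))) ⟨_, hsocle hx⟩
  obtain ⟨s, rfl⟩ := Ideal.Quotient.mk_surjective r
  refine ⟨s, Ideal.Quotient.eq.1 ?_⟩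
  rw [map_mul]
  exact (congrArg Subtype.val hr).symm

theorem mul_mem_of_covBy {A B : Ideal S} (h : A ⋖ B) {s b : S} (hs : s ∈ maximalIdeal S)
    (hb : b ∈ B) : s * b ∈ A := by
  by_contra hsb
  have hAB : A ⊔ Ideal.span {s * b} = B := sup_span_singleton_eq_of_covBy h (B.mul_mem_left s hb) hsb
  obtain ⟨a, ha, c, hc, hac⟩ := Submodule.mem_sup.1 (hAB ▸ hb)
  obtain ⟨t, rfl⟩ := Ideal.mem_span_singleton'.1 hc
  have hu : IsUnit (1 - t * s) :=
    isUnit_one_sub_self_of_mem_nonunits _ ((maximalIdeal S).mul_mem_left t hs)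
  have hbA : b ∈ A := by
    refine (Ideal.unit_mul_mem_iff_mem A hu).1 ?_
    convert ha using 1
    linear_combination -hac
  exact hsb (A.mul_mem_left s hbA)

theorem colon_wcovBy_colon
    (hsoc : ∀ {x y : S}, (∀ s ∈ maximalIdeal S, s * x ∈ I) →
      (∀ s ∈ maximalIdeal S, s * y ∈ I) → y ∉ I → ∃ s, x - s * y ∈ I)
    {A B : Ideal S} (h : A ⋖ B) : I.colon B ⩿ I.colon A := by
  obtain ⟨b, hbB, hbA⟩ := SetLike.exists_of_lt h.lt
  have hAB : A ⊔ Ideal.span {b} = B := sup_span_singleton_eq_of_covBy h hbB hbA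
  have hmem (x : S) : x ∈ I.colon B ↔ x ∈ I.colon A ∧ x * b ∈ I := by
    rw [← hAB, colon_sup, Ideal.mem_inf, Ideal.mem_colon_span_singleton]
  have hkill {x : S} (hx : x ∈ I.colon A) : ∀ s ∈ maximalIdeal S, s * (x * b) ∈ I := by
    intro s hs
    rw [mul_left_comm]
    exact Submodule.mem_colon.1 hx _ (mul_mem_of_covBy h hs hbB)
  refine ⟨Submodule.colon_mono le_rfl h.le, fun C hC hCA => hCA.not_ge fun x hx => ?_⟩
  obtain ⟨y, hyC, hyB⟩ := SetLike.exists_of_lt hC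
  have hyA := hCA.le hyC
  obtain ⟨s, hs⟩ := hsoc (hkill hx) (hkill hyA) fun hyb => hyB ((hmem y).2 ⟨hyA, hyb⟩)
  have hxy : x - s * y ∈ I.colon B :=
    (hmem _).2 ⟨sub_mem hx (Ideal.mul_mem_left _ s hyA), by rwa [sub_mul, mul_assoc]⟩
  simpa using add_mem (hC.le hxy) (C.mul_mem_left s hyC)

/-- Duality over an Artinian Gorenstein quotient `S ⧸ I`: the lengths of `S ⧸ (I : A)` and
`S ⧸ A` add up to that of `S ⧸ I`. -/
theorem length_quotient_colon_add_length_quotient [IsNoetherianRing S] [IsArtinian S (S ⧸ I)]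
    (hsoc : ∀ {x y : S}, (∀ s ∈ maximalIdeal S, s * x ∈ I) →
      (∀ s ∈ maximalIdeal S, s * y ∈ I) → y ∉ I → ∃ s, x - s * y ∈ I)
    {A : Ideal S} (hA : I ≤ A) :
    Module.length S (S ⧸ I.colon A) + Module.length S (S ⧸ A) = Module.length S (S ⧸ I) := by
  let f : Set.Ici I → ℕ∞ := fun A =>
    Module.length S (S ⧸ I.colon A.1) + Module.length S (S ⧸ A.1)
  let e := Submodule.comapMkQRelIso I
  have : WellFoundedLT (Set.Ici I) := e.symm.toOrderEmbedding.wellFoundedLT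
  have : WellFoundedGT (Set.Ici I) := e.symm.toOrderEmbedding.wellFoundedGT
  have hf : Antitone f := by
    refine antitone_of_covBy_le fun A B hAB => ?_
    have hcov : A.1 ⋖ B.1 := (Set.OrdConnected.apply_covBy_apply_iff
      (OrderEmbedding.subtype (· ∈ Set.Ici I))
      (by simpa only [OrderEmbedding.coe_subtype, Subtype.range_coe_subtype] using!
        Set.ordConnected_Ici)).2 hAB
    simp only [f]
    rw [length_quotient_of_covBy hcov, add_comm _ (1 : ℕ∞), ← add_assoc]
    gcongr
    exact length_quotient_le_of_wcovBy (colon_wcovBy_colon hsoc hcov)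
  have hle := hf (show (⟨I, le_refl I⟩ : Set.Ici I) ≤ ⟨A, hA⟩ from hA)
  have hge := hf (show (⟨A, hA⟩ : Set.Ici I) ≤ ⟨⊤, hA.trans le_top⟩ from le_top)
  have hbot : Module.length S (S ⧸ I.colon (I : Set S)) = 0 := by
    rw [(Submodule.colon_eq_top_iff_subset _).2 subset_rfl, Module.length_eq_zero]
  have htop : Module.length S (S ⧸ I.colon ((⊤ : Ideal S) : Set S)) = Module.length S (S ⧸ I) := by
    rw [Submodule.top_coe, Submodule.colon_univ]
  simp only [f, hbot, htop, Module.length_eq_zero, zero_add, add_zero] at hle hge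
  exact le_antisymm hle hge

end Local

/-- If `I = JK` is an `m`-primary product of proper ideals with `I : K = J`, `I : J = K`, and
`S/I` Artinian Gorenstein, then `length (S/(J+K)) = length ((J ∩ K)/JK)`. -/
theorem length_quotient_sum_eq_length_inf_quotient_product
    (S : Type u) [CommRing S] [IsLocalRing S] [IsNoetherianRing S]
    (J K I : Ideal S) (hJ : J ≠ ⊤) (hK : K ≠ ⊤) (hI : I = J * K)
    (hprim : ∃ n : ℕ, (maximalIdeal S) ^ n ≤ I)
    (hcolK : Submodule.colon I K = J) (hcolJ : Submodule.colon I J = K)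
    (hgor : IsArtinianGorensteinLocalRing (S ⧸ I)) :
    moduleLength S (S ⧸ (J ⊔ K)) =
      moduleLength S (↥(J ⊓ K) ⧸ (Submodule.comap (J ⊓ K).subtype (J * K))) := by
  obtain ⟨hart, hloc, hsimple⟩ := hgor
  have : IsArtinian S (S ⧸ I) :=
    isArtinian_of_surjective_algebraMap (R := S ⧸ I) Ideal.Quotient.mk_surjective
  have hIJK : I ≤ J ⊓ K := hI ▸ Ideal.mul_le_inf
  have hcol : I.colon (J ⊔ K : Ideal S) = J ⊓ K := by
    rw [colon_sup, hcolJ, hcolK, inf_comm]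
  have hdual := length_quotient_colon_add_length_quotient (A := J ⊔ K)
    (exists_sub_mul_mem_of_isSimpleModule_socle I) (hIJK.trans (inf_le_left.trans le_sup_left))
  have hadd := length_quotient_eq_add hIJK
  have hfin : Module.length S (S ⧸ (J ⊓ K)) ≠ ⊤ := by
    have : IsArtinian S (S ⧸ (J ⊓ K)) :=
      isArtinian_of_surjective _ (Submodule.factor hIJK) (Submodule.factor_surjective hIJK)
    exact Module.length_ne_top
  rw [hcol, hadd] at hdual
  rw [moduleLength, moduleLength, ← Module.length_eq_height, ← Module.length_eq_height, ← hI]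
  exact WithTop.add_left_cancel hfin hdual
end

section
/- Let (S,m) be a Noetherian local ring, and let J and K be proper ideals such that the ideal I = JK is m-primary, I : K = J, I : J = K, and S/I is an Artinian Gorenstein local ring. Then length(Tor_0^S(S/J, S/K)) = length(Tor_1^S(S/J, S/K)); equivalently, length(S/(J+K)) = length(Tor_1^S(S/J, S/K)). -/
universe u

open IsLocalRing CategoryTheory

theorem moduleLength_eq_length (R M : Type*) [Ring R] [AddCommGroup M] [Module R M] :
    moduleLength R M = Module.length R M :=
  (Module.length_eq_height R M).symm

theorem Module.length_le_add_of_exact {R M N P : Type*} [Ring R] [AddCommGroup M] [Module R M]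
    [AddCommGroup N] [Module R N] [AddCommGroup P] [Module R P]
    (f : N →ₗ[R] M) (g : M →ₗ[R] P) (h : Function.Exact f g) :
    Module.length R M ≤ Module.length R N + Module.length R P := by
  rw [Module.length_eq_add_of_exact (LinearMap.ker g).subtype g.rangeRestrict
    (Submodule.injective_subtype _) g.surjective_rangeRestrict ?_, h.linearMap_ker_eq]
  · exact add_le_add (Module.length_le_of_surjective f.rangeRestrict f.surjective_rangeRestrict)
      (Module.length_le_of_injective _ (Submodule.injective_subtype _))
  · rw [LinearMap.exact_iff, LinearMap.ker_rangeRestrict, Submodule.range_subtype]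

namespace IsArtinianGorensteinLocalRing

variable {S : Type*} [CommRing S] {I : Ideal S}

theorem isFiniteLength_quotient {J : Ideal S} (hIJ : I ≤ J)
    (h : IsArtinianGorensteinLocalRing (S ⧸ I)) : IsFiniteLength S (S ⧸ J) := by
  have := h.1
  have hI : IsFiniteLength S (S ⧸ I) := by
    rw [← Module.length_ne_top_iff,
      Module.length_eq_of_surjective (R := S ⧸ I) Ideal.Quotient.mk_surjective]
    exact Module.length_ne_top
  exact hI.of_surjective (f := Submodule.factor hIJ) (Submodule.factor_surjective hIJ)

variable [IsLocalRing S]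

theorem length_hom_le_one (h : IsArtinianGorensteinLocalRing (S ⧸ I))
    (M : Type*) [AddCommGroup M] [Module S M] [IsSimpleModule S M] :
    Module.length S (M →ₗ[S] S ⧸ I) ≤ 1 := by
  obtain ⟨_, _, hsoc⟩ := h
  have := IsSimpleModule.nontrivial S M
  obtain ⟨x, hx⟩ := exists_ne (0 : M)
  have hmax : LinearMap.ker (LinearMap.toSpanSingleton S M x) = maximalIdeal S :=
    IsLocalRing.eq_maximalIdeal (IsSimpleModule.ker_toSpanSingleton_isMaximal S hx)
  have hmem (f : M →ₗ[S] S ⧸ I) :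
      f x ∈ ((⊥ : Ideal (S ⧸ I)).colon (maximalIdeal (S ⧸ I))).restrictScalars S := by
    rw [Submodule.restrictScalars_mem, Submodule.mem_colon]
    intro r hr
    obtain ⟨s, rfl⟩ := Ideal.Quotient.mk_surjective r
    have hs : s ∈ maximalIdeal S := fun hu ↦ hr (hu.map _)
    rw [← hmax, LinearMap.mem_ker, LinearMap.toSpanSingleton_apply] at hs
    have : s • f x = 0 := by rw [← map_smul, hs, map_zero]
    rw [Submodule.mem_bot, smul_eq_mul, mul_comm, ← this, Algebra.smul_def]
    rfl
  have hinj : Function.Injective ((LinearMap.applyₗ x).codRestrict _ hmem) := by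
    rw [injective_iff_map_eq_zero]
    intro f hf
    ext y
    obtain ⟨s, rfl⟩ := IsSimpleModule.toSpanSingleton_surjective S hx y
    have : f x = 0 := congrArg Subtype.val hf
    simp [this]
  refine (Module.length_le_of_injective _ hinj).trans_eq ?_
  exact (Module.length_eq_of_surjective (R := S ⧸ I)
    (M := ↥((⊥ : Ideal (S ⧸ I)).colon (maximalIdeal (S ⧸ I))))
    Ideal.Quotient.mk_surjective).trans (Module.length_eq_one _ _)

theorem length_hom_le (h : IsArtinianGorensteinLocalRing (S ⧸ I))
    {M : Type*} [AddCommGroup M] [Module S M] (hM : IsFiniteLength S M) :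
    Module.length S (M →ₗ[S] S ⧸ I) ≤ Module.length S M := by
  induction hM with
  | of_subsingleton => simp [Module.length_eq_zero]
  | @of_simple_quotient M _ _ N _ _ ih =>
    have hexact : Function.Exact (N.mkQ.lcomp S (S ⧸ I)) (N.subtype.lcomp S (S ⧸ I)) :=
      LinearMap.exact_lcomp_of_exact_of_surjective _ (LinearMap.exact_subtype_mkQ N)
        N.mkQ_surjective
    have hle : Module.length S (M →ₗ[S] S ⧸ I) ≤
        Module.length S (M ⧸ N →ₗ[S] S ⧸ I) + Module.length S (N →ₗ[S] S ⧸ I) :=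
      Module.length_le_add_of_exact _ _ hexact
    rw [Module.length_eq_add_of_exact N.subtype N.mkQ N.injective_subtype N.mkQ_surjective
      (LinearMap.exact_subtype_mkQ N), Module.length_eq_one S (M ⧸ N), add_comm]
    exact hle.trans (add_le_add (h.length_hom_le_one _) ih)

theorem length_le_of_pairing (h : IsArtinianGorensteinLocalRing (S ⧸ I))
    {M N : Type*} [AddCommGroup M] [Module S M] [AddCommGroup N] [Module S N]
    (hM : IsFiniteLength S M) (β : N →ₗ[S] M →ₗ[S] S ⧸ I) (hβ : Function.Injective β) :
    Module.length S N ≤ Module.length S M :=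
  (Module.length_le_of_injective β hβ).trans (h.length_hom_le hM)

theorem length_quotient_smul_top {J K : Ideal S}
    (h : IsArtinianGorensteinLocalRing (S ⧸ (J * K)))
    (hcolK : Submodule.colon (J * K) (K : Set S) = J) :
    Module.length S (K ⧸ (J • ⊤ : Submodule S K)) = Module.length S (S ⧸ J) := by
  have hJ : J ≤ LinearMap.ker
      ((LinearMap.lsmul S (S ⧸ (J * K))).compl₂ ((J * K).mkQ ∘ₗ K.subtype)) := by
    intro s hs
    ext x
    exact (Submodule.Quotient.mk_eq_zero _).mpr (Ideal.mul_mem_mul hs x.2)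
  let γ : K →ₗ[S] (S ⧸ J) →ₗ[S] S ⧸ (J * K) := (Submodule.liftQ J _ hJ).flip
  have hγ (x : K) (s : S) : γ x (Submodule.Quotient.mk s) = Submodule.Quotient.mk (s * x) := rfl
  have hker : LinearMap.ker γ = J • ⊤ := by
    rw [← Submodule.comap_map_eq_of_injective K.injective_subtype (J • ⊤),
      Submodule.map_smul'', Submodule.map_top, Submodule.range_subtype]
    ext x
    constructor
    · intro hx
      have h1 : γ x (Submodule.Quotient.mk 1) = 0 := LinearMap.congr_fun hx _
      rw [hγ, one_mul] at h1
      exact (Submodule.Quotient.mk_eq_zero (J * K)).mp h1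
    · intro hx
      ext
      exact (Submodule.Quotient.mk_eq_zero _).mpr (Ideal.mul_mem_left _ _ hx)
  let β : (K ⧸ (J • ⊤ : Submodule S K)) →ₗ[S] (S ⧸ J) →ₗ[S] S ⧸ (J * K) :=
    Submodule.liftQ _ γ hker.ge
  have hβ : LinearMap.ker β = ⊥ := Submodule.ker_liftQ_eq_bot' _ _ hker.symm
  have hle := h.length_le_of_pairing (h.isFiniteLength_quotient Ideal.mul_le_left) β
    (LinearMap.ker_eq_bot.mp hβ)
  refine hle.antisymm (h.length_le_of_pairing ?_ β.flip ?_)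
  · exact Module.length_ne_top_iff.mp (ne_top_of_le_ne_top
      (Module.length_ne_top_iff.mpr (h.isFiniteLength_quotient Ideal.mul_le_left)) hle)
  · rw [injective_iff_map_eq_zero]
    intro s hs
    obtain ⟨s, rfl⟩ := Submodule.Quotient.mk_surjective _ s
    rw [Submodule.Quotient.mk_eq_zero, ← hcolK, Submodule.mem_colon]
    intro x hx
    exact (Submodule.Quotient.mk_eq_zero _).mp
      (LinearMap.congr_fun hs (Submodule.Quotient.mk ⟨x, hx⟩))

end IsArtinianGorensteinLocalRing

namespace CategoryTheory

open Limits

namespace ProjectiveResolution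

variable {C : Type*} [Category* C] [Abelian C]

/-- The augmentation of a projective resolution of `Z`, as a morphism with target `Z`. -/
noncomputable def augmentation {Z : C} (R : ProjectiveResolution Z) : R.complex.X 0 ⟶ Z :=
  R.π.f 0

instance {Z : C} (R : ProjectiveResolution Z) : Epi R.augmentation :=
  inferInstanceAs (Epi (R.π.f 0))

theorem d_comp_augmentation {Z : C} (R : ProjectiveResolution Z) :
    R.complex.d 1 0 ≫ R.augmentation = 0 :=
  R.complex_d_comp_π_f_zero

/-- The augmentation is a cokernel of the first differential. -/
noncomputable def isColimitAugmentation {Z : C} (R : ProjectiveResolution Z) :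
    IsColimit (CokernelCofork.ofπ R.augmentation R.d_comp_augmentation) :=
  R.isColimitCokernelCofork

/-- Splicing a projective resolution of the kernel of an epimorphism `P ⟶ Z` from a projective
object with this epimorphism gives a projective resolution of `Z`. -/
noncomputable def ofShortExact {S : ShortComplex C} (hS : S.ShortExact)
    [Projective S.X₂] (R : ProjectiveResolution S.X₁) : ProjectiveResolution S.X₃ :=
  have w : R.complex.d 1 0 ≫ R.augmentation ≫ S.f = 0 := by
    rw [← Category.assoc, R.d_comp_augmentation, zero_comp]
  have w' : (R.augmentation ≫ S.f) ≫ S.g = 0 := by rw [Category.assoc, S.zero, comp_zero]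
  have := hS.epi_g
  have := hS.mono_f
  { complex := R.complex.augment (R.augmentation ≫ S.f) w
    projective := by
      rintro (_ | n)
      · assumption
      · exact R.projective n
    π := (ChainComplex.toSingle₀Equiv _ _).symm ⟨S.g, w'⟩
    quasiIso := ⟨fun n ↦ by
      cases n
      · rw [ChainComplex.quasiIsoAt₀_iff, ShortComplex.quasiIso_iff_of_zeros']
        · have hex : (ShortComplex.mk (R.augmentation ≫ S.f) S.g w').Exact := by
            let φ : ShortComplex.mk (R.augmentation ≫ S.f) S.g w' ⟶ S :=
              { τ₁ := R.augmentation, τ₂ := 𝟙 _, τ₃ := 𝟙 _ }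
            have : Epi φ.τ₁ := inferInstanceAs (Epi R.augmentation)
            have : IsIso φ.τ₂ := inferInstanceAs (IsIso (𝟙 _))
            have : Mono φ.τ₃ := inferInstanceAs (Mono (𝟙 _))
            exact (ShortComplex.exact_iff_of_epi_of_isIso_of_mono φ).2 hS.exact
          refine (ShortComplex.exact_and_epi_g_iff_of_iso ?_).2 ⟨hex, inferInstanceAs (Epi S.g)⟩
          refine ShortComplex.isoMk (Iso.refl _) (Iso.refl _) (Iso.refl _)
            ((Category.id_comp _).trans (Category.comp_id _).symm) ?_
          refine (Category.id_comp S.g).trans (Eq.trans ?_ (Category.comp_id _).symm)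
          exact (ChainComplex.toSingle₀Equiv_symm_apply_f_zero
            (C := R.complex.augment (R.augmentation ≫ S.f) w) S.g w').symm
        all_goals rfl
      · rw [quasiIsoAt_iff_exactAt']
        · rename_i n
          rw [HomologicalComplex.exactAt_iff' _ (n + 1 + 1) (n + 1) n (by simp) (by simp)]
          cases n with
          | zero =>
            let T : ShortComplex C := ShortComplex.mk (R.complex.d 1 0) (R.augmentation ≫ S.f) w
            let φ : ShortComplex.mk _ _ R.d_comp_augmentation ⟶ T :=
              { τ₁ := 𝟙 _, τ₂ := 𝟙 _, τ₃ := S.f }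
            have : Epi φ.τ₁ := inferInstanceAs (Epi (𝟙 _))
            have : IsIso φ.τ₂ := inferInstanceAs (IsIso (𝟙 _))
            have : Mono φ.τ₃ := inferInstanceAs (Mono S.f)
            exact (ShortComplex.exact_iff_of_epi_of_isIso_of_mono φ).1
              (ShortComplex.exact_of_g_is_cokernel _ R.isColimitAugmentation)
          | succ n => exact R.exact_succ n
        · apply ChainComplex.exactAt_succ_single_obj⟩ }

end ProjectiveResolution

namespace Functor

variable {C D : Type*} [Category* C] [Abelian C] [HasProjectiveResolutions C]
  [Category* D] [Abelian D] (F : C ⥤ D) [F.Additive] [PreservesFiniteColimits F]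

/-- Dimension shifting: the first left derived functor of a right exact functor `F` at `Z` is the
kernel of `F.obj L ⟶ F.obj P` for a short exact sequence `0 ⟶ L ⟶ P ⟶ Z ⟶ 0` with `P`
projective. -/
noncomputable def leftDerivedOneIsoKernel {S : ShortComplex C} (hS : S.ShortExact)
    [Projective S.X₂] : (F.leftDerived 1).obj S.X₃ ≅ Limits.kernel (F.map S.f) :=
  let R := projectiveResolution S.X₁
  let K := (F.mapHomologicalComplex (ComplexShape.down ℕ)).obj
    (ProjectiveResolution.ofShortExact hS R).complex
  let e : (F.leftDerived 1).obj S.X₃ ≅ (K.sc' 2 1 0).homology :=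
    (ProjectiveResolution.ofShortExact hS R).isoLeftDerivedObj F 1 ≪≫
      (HomologicalComplex.homologyFunctorIso' D (ComplexShape.down ℕ) 2 1 0
        (by simp) (by simp)).app K
  have wp : F.map (R.complex.d 1 0) ≫ F.map R.augmentation = 0 := by
    rw [← F.map_comp, R.d_comp_augmentation, F.map_zero]
  let hc : IsColimit (CokernelCofork.ofπ (F.map R.augmentation) wp) :=
    CokernelCofork.mapIsColimit _ R.isColimitAugmentation F
  have hdesc : hc.desc (CokernelCofork.ofπ _ (K.sc' 2 1 0).zero) = F.map S.f := by
    refine Cofork.IsColimit.hom_ext hc ?_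
    refine (hc.fac _ _).trans ?_
    exact F.map_comp _ _
  let h : (K.sc' 2 1 0).RightHomologyData :=
    { Q := F.obj S.X₁
      H := Limits.kernel (F.map S.f)
      p := F.map R.augmentation
      ι := kernel.ι (F.map S.f)
      wp := wp
      hp := hc
      wι := (congrArg _ hdesc).trans (kernel.condition _)
      hι := KernelFork.isLimitOfIsLimitOfIff' (kernelIsKernel (F.map S.f)) _
        (fun _ φ ↦ by rw [← hdesc]; rfl) }
  e ≪≫ h.homologyIso

end Functor

end CategoryTheory

open TensorProduct in
/-- Tensoring an inclusion `K ≤ S` of an ideal with a module `A`: if `A ⊗ K` and `A` have the same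
finite length, then the kernel and the cokernel of `A ⊗ K → A` have the same length. -/
theorem Module.length_ker_lTensor_subtype {S A : Type*} [CommRing S] [AddCommGroup A] [Module S A]
    (K : Ideal S) (hA : IsFiniteLength S A)
    (h : Module.length S (A ⊗[S] K) = Module.length S A) :
    Module.length S (LinearMap.ker (K.subtype.lTensor A)) = Module.length S (A ⊗[S] (S ⧸ K)) := by
  have h₁ := Module.length_eq_add_of_exact (LinearMap.ker (K.subtype.lTensor A)).subtype
    (K.subtype.lTensor A).rangeRestrict (Submodule.injective_subtype _)
    (LinearMap.surjective_rangeRestrict _)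
    (by rw [LinearMap.exact_iff, LinearMap.ker_rangeRestrict, Submodule.range_subtype])
  have h₂ := Module.length_eq_add_of_exact (LinearMap.range (K.subtype.lTensor A)).subtype
    (K.mkQ.lTensor A) (Submodule.injective_subtype _)
    (LinearMap.lTensor_surjective A K.mkQ_surjective)
    (by
      rw [LinearMap.exact_iff, Submodule.range_subtype]
      exact (lTensor_exact A (LinearMap.exact_subtype_mkQ K) K.mkQ_surjective).linearMap_ker_eq)
  rw [(TensorProduct.rid S A).length_eq] at h₂
  rw [h, h₂, add_comm (Module.length S (LinearMap.ker _))] at h₁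
  exact (ENat.add_right_injective_of_ne_top
    (ne_top_of_le_ne_top (Module.length_ne_top_iff.mpr hA) (h₂ ▸ le_self_add)) h₁).symm

/-- `Tor₁ (A, S ⧸ K)` is the kernel of `A ⊗ K ⟶ A ⊗ S`. -/
theorem length_tor_one_quotient {S : Type u} [CommRing S] (A : ModuleCat.{u} S) (K : Ideal S) :
    Module.length S (((Tor (ModuleCat.{u} S) 1).obj A).obj (ModuleCat.of S (S ⧸ K))) =
      Module.length S (LinearMap.ker (K.subtype.lTensor A)) := by
  have hS : (ShortComplex.mk (ModuleCat.ofHom K.subtype) (ModuleCat.ofHom K.mkQ)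
      (by ext x; exact (Submodule.Quotient.mk_eq_zero K).mpr x.2)).ShortExact :=
    ModuleCat.shortComplex_shortExact _ (LinearMap.exact_subtype_mkQ K) K.injective_subtype
      K.mkQ_surjective
  let F := (MonoidalCategory.tensoringLeft (ModuleCat.{u} S)).obj A
  have : Limits.PreservesFiniteColimits F :=
    inferInstanceAs (Limits.PreservesFiniteColimits (MonoidalCategory.tensorLeft A))
  let e := F.leftDerivedOneIsoKernel hS ≪≫ ModuleCat.kernelIsoKer _
  exact e.toLinearEquiv.length_eq

theorem length_tor_zero {S : Type u} [CommRing S] (A B : ModuleCat.{u} S) :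
    Module.length S (((Tor (ModuleCat.{u} S) 0).obj A).obj B) =
      Module.length S (TensorProduct S A B) := by
  let F := (MonoidalCategory.tensoringLeft (ModuleCat.{u} S)).obj A
  have : Limits.PreservesFiniteColimits F :=
    inferInstanceAs (Limits.PreservesFiniteColimits (MonoidalCategory.tensorLeft A))
  exact (F.leftDerivedZeroIsoSelf.app B).toLinearEquiv.length_eq

open TensorProduct in
theorem length_quotient_tensor_quotient {S : Type*} [CommRing S] (J K : Ideal S) :
    Module.length S ((S ⧸ J) ⊗[S] (S ⧸ K)) = Module.length S (S ⧸ (J ⊔ K)) := by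
  rw [(quotTensorEquivQuotSMul (S ⧸ K) J).length_eq, sup_comm,
    ← (Submodule.quotientQuotientEquivQuotientSup K J).length_eq]
  have : (J • ⊤ : Submodule S (S ⧸ K)) = Submodule.map K.mkQ J := by
    rw [← LinearMap.range_eq_top.mpr K.mkQ_surjective, ← Submodule.map_top, ← Submodule.map_smul'',
      smul_eq_mul, Ideal.mul_top]
  rw [this]

/-- If `I = JK` is an `m`-primary product of proper ideals with `I : K = J`, `I : J = K`, and
`S/I` Artinian Gorenstein, then `length (Tor_0(S/J, S/K)) = length (Tor_1(S/J, S/K))`;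
equivalently `length (S/(J+K)) = length (Tor_1(S/J, S/K))`. -/
theorem length_tor_zero_eq_length_tor_one
    (S : Type u) [CommRing S] [IsLocalRing S] [IsNoetherianRing S]
    (J K I : Ideal S) (hJ : J ≠ ⊤) (hK : K ≠ ⊤) (hI : I = J * K)
    (hprim : ∃ n : ℕ, (maximalIdeal S) ^ n ≤ I)
    (hcolK : Submodule.colon I K = J) (hcolJ : Submodule.colon I J = K)
    (hgor : IsArtinianGorensteinLocalRing (S ⧸ I)) :
    moduleLength S
        (((Tor (ModuleCat.{u} S) 0).obj (ModuleCat.of S (S ⧸ J))).obj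
          (ModuleCat.of S (S ⧸ K))) =
      moduleLength S
        (((Tor (ModuleCat.{u} S) 1).obj (ModuleCat.of S (S ⧸ J))).obj
          (ModuleCat.of S (S ⧸ K))) ∧
    moduleLength S (S ⧸ (J ⊔ K)) =
      moduleLength S
        (((Tor (ModuleCat.{u} S) 1).obj (ModuleCat.of S (S ⧸ J))).obj
          (ModuleCat.of S (S ⧸ K))) := by
  subst hI
  simp only [moduleLength_eq_length]
  have h₀ := length_tor_zero (ModuleCat.of S (S ⧸ J)) (ModuleCat.of S (S ⧸ K))
  have h₁ := (length_tor_one_quotient (ModuleCat.of S (S ⧸ J)) K).trans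
    (Module.length_ker_lTensor_subtype K (hgor.isFiniteLength_quotient Ideal.mul_le_left)
      ((TensorProduct.quotTensorEquivQuotSMul K J).length_eq.trans
        (hgor.length_quotient_smul_top hcolK)))
  exact ⟨h₀.trans h₁.symm, (length_quotient_tensor_quotient J K).symm.trans h₁.symm⟩
end

section
/- Let (R,m) be a Gorenstein local ring and let J be an ideal generated by a system of parameters of R. Then J has a unique minimal (strict) overideal; equivalently, the socle (0 :_{R/J} m) of the Artinian ring R/J is a one-dimensional vector space over the residue field. -/
universe u

open IsLocalRing

section

open CategoryTheory

/-- A Gorenstein local ring has finite injective dimension over itself. -/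
theorem IsGorensteinLocalRing.exists_hasInjectiveDimensionLT {R : Type u} [CommRing R]
    (h : IsGorensteinLocalRing R) :
    ∃ n : ℕ, HasInjectiveDimensionLT (ModuleCat.of R R) n := by
  obtain ⟨-, -, n, hn⟩ := h
  refine ⟨n + 1, hasInjectiveDimensionLT_of_enoughProjectives _ _ fun M ↦ ?_⟩
  let P := projectiveResolution M
  have hsub := hn (n + 1) n.lt_succ_self M
  have hz : Limits.IsZero ((P.complex.linearYonedaObj R (ModuleCat.of R R)).homology (n + 1)) :=
    ((ModuleCat.isZero_iff_subsingleton).2 hsub).of_iso (P.isoExt (n + 1) _).symm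
  rw [← HomologicalComplex.exactAt_iff_isZero_homology,
    HomologicalComplex.exactAt_iff' _ n (n + 1) (n + 2) (by simp) (by simp),
    ShortComplex.moduleCat_exact_iff] at hz
  refine subsingleton_of_forall_eq 0 fun α ↦ ?_
  obtain ⟨f, hf, rfl⟩ := P.extMk_surjective α (n + 2) rfl
  rw [P.extMk_eq_zero_iff f (n + 2) rfl hf n rfl]
  exact hz f hf

section

variable {R : Type u} [CommRing R]

open Abelian

/-- If `Ext^n(X₂, N)` and `Ext^(n+1)(X₃, N)` vanish, then so does `Ext^n(X₁, N)`. -/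
theorem ModuleCat.subsingleton_ext_X₁ {S : ShortComplex (ModuleCat.{u} R)} (hS : S.ShortExact)
    (N : ModuleCat.{u} R) (n : ℕ) [Subsingleton (Ext S.X₂ N n)]
    [Subsingleton (Ext S.X₃ N (n + 1))] : Subsingleton (Ext S.X₁ N n) := by
  refine subsingleton_of_forall_eq 0 fun α ↦ ?_
  obtain ⟨β, rfl⟩ := Ext.contravariant_sequence_exact₁ hS N α (add_comm 1 n)
    (Subsingleton.elim _ _)
  rw [Subsingleton.elim β 0, Ext.comp_zero]

/-- If `Ext^n(X₁, N)` and `Ext^n(X₃, N)` vanish, then so does `Ext^n(X₂, N)`. -/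
theorem ModuleCat.subsingleton_ext_X₂ {S : ShortComplex (ModuleCat.{u} R)} (hS : S.ShortExact)
    (N : ModuleCat.{u} R) (n : ℕ) [Subsingleton (Ext S.X₁ N n)]
    [Subsingleton (Ext S.X₃ N n)] : Subsingleton (Ext S.X₂ N n) := by
  refine subsingleton_of_forall_eq 0 fun α ↦ ?_
  obtain ⟨β, rfl⟩ := Ext.contravariant_sequence_exact₂ hS N α (Subsingleton.elim _ _)
  rw [Subsingleton.elim β 0, Ext.comp_zero]

/-- If `Ext^1(R ⧸ I, R) = 0`, then every linear map `I → R` is a multiplication map. -/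
theorem exists_mul_eq_of_subsingleton_ext {I : Ideal R}
    (h : Subsingleton (Ext (ModuleCat.of R (R ⧸ I)) (ModuleCat.of R R) 1)) (f : I →ₗ[R] R) :
    ∃ c : R, ∀ i : I, f i = c * i := by
  let S := ModuleCat.shortComplexOfCompEqZero I.subtype I.mkQ
    (LinearMap.exact_subtype_mkQ I).linearMap_comp_eq_zero
  have hS : S.ShortExact := ModuleCat.shortComplex_shortExact S
    (LinearMap.exact_subtype_mkQ I) I.injective_subtype I.mkQ_surjective
  obtain ⟨β, hβ⟩ := Ext.contravariant_sequence_exact₁ hS (ModuleCat.of R R)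
    (Ext.mk₀ (ModuleCat.ofHom f)) (add_comm 1 0) (Subsingleton.elim _ _)
  obtain ⟨g, rfl⟩ := Ext.homEquiv₀.symm.surjective β
  rw [Ext.homEquiv₀_symm_apply, Ext.mk₀_comp_mk₀] at hβ
  have hg : S.f ≫ g = ModuleCat.ofHom f := Ext.homEquiv₀.symm.injective (by simpa using hβ)
  refine ⟨g.hom (1 : R), fun i ↦ ?_⟩
  have h1 : g.hom (i : R) = f i := LinearMap.congr_fun (congrArg ModuleCat.Hom.hom hg) i
  have h2 := g.hom.map_smul (i : R) (1 : R)
  rw [← h1, mul_comm]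
  simpa using h2

variable [IsNoetherianRing R] [IsLocalRing R]

/-- If `Ext^(n+1)(-, N)` vanishes on finite modules, then `Ext^n(R ⧸ p, N) = 0` for every nonmaximal
prime `p`. -/
theorem subsingleton_ext_quotient_prime (N : ModuleCat.{u} R) [Module.Finite R N] (n : ℕ)
    (h : ∀ M : ModuleCat.{u} R, Module.Finite R M → Subsingleton (Ext M N (n + 1)))
    (p : Ideal R) [p.IsPrime] (hp : p ≠ maximalIdeal R) :
    Subsingleton (Ext (ModuleCat.of R (R ⧸ p)) N n) := by
  obtain ⟨x, hxm, hxp⟩ : ∃ x ∈ maximalIdeal R, x ∉ p := by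
    by_contra! hc
    exact hp (le_antisymm (le_maximalIdeal (Ideal.IsPrime.ne_top ‹_›)) hc)
  let f : (R ⧸ p) →ₗ[R] (R ⧸ p) := LinearMap.lsmul R _ x
  have hf : Function.Injective f := by
    rw [← LinearMap.ker_eq_bot, LinearMap.ker_eq_bot']
    intro m hm
    have : Ideal.Quotient.mk p x * m = 0 := hm
    exact (mul_eq_zero.1 this).resolve_left (by rwa [Ideal.Quotient.eq_zero_iff_mem])
  let S := ModuleCat.shortComplexOfCompEqZero _ _ f.exact_map_mkQ_range.linearMap_comp_eq_zero
  have hS : S.ShortExact := ModuleCat.shortComplex_shortExact S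
      f.exact_map_mkQ_range hf (Submodule.mkQ_surjective _)
  have := h S.X₃ inferInstance
  have hfin : Module.Finite R (Ext (ModuleCat.of R (R ⧸ p)) N n) := inferInstance
  have hle : (⊤ : Submodule R (Ext (ModuleCat.of R (R ⧸ p)) N n)) ≤
      maximalIdeal R • (⊤ : Submodule R (Ext (ModuleCat.of R (R ⧸ p)) N n)) := by
    intro α _
    obtain ⟨β, rfl⟩ := Ext.contravariant_sequence_exact₁ hS N α (add_comm 1 n)
      (Subsingleton.elim _ _)
    have : S.f = x • 𝟙 (ModuleCat.of R (R ⧸ p)) := by ext; rfl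
    rw [this, Ext.mk₀_smul, Ext.smul_comp, Ext.mk₀_id_comp]
    exact Submodule.smul_mem_smul hxm trivial
  have := Submodule.eq_bot_of_le_smul_of_le_jacobson_bot _ _ hfin.fg_top hle
    (maximalIdeal_le_jacobson _)
  exact (Submodule.subsingleton_iff R).1 (subsingleton_of_bot_eq_top this.symm)

/-- If `R` has nonzero socle and `Ext^(n+2)(-, R)` vanishes on finite modules, then so does
`Ext^(n+1)(-, R)`. -/
theorem subsingleton_ext_of_socle {s : R} (hs : s ≠ 0) (hms : ∀ a ∈ maximalIdeal R, a * s = 0)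
    (n : ℕ)
    (h : ∀ M : ModuleCat.{u} R, Module.Finite R M →
      Subsingleton (Ext M (ModuleCat.of R R) (n + 2)))
    (M : ModuleCat.{u} R) (hM : Module.Finite R M) :
    Subsingleton (Ext M (ModuleCat.of R R) (n + 1)) := by
  suffices H : ∀ (M : Type u) [AddCommGroup M] [Module R M] [Module.Finite R M],
      Subsingleton (Ext (ModuleCat.of R M) (ModuleCat.of R R) (n + 1)) from H M
  clear! M
  intro M _ _ hM
  have key (p : Ideal R) [p.IsPrime] :
      Subsingleton (Ext (ModuleCat.of R (R ⧸ p)) (ModuleCat.of R R) (n + 1)) := by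
    by_cases hp : p = maximalIdeal R
    · subst hp
      let f : (R ⧸ maximalIdeal R) →ₗ[R] R :=
        Submodule.liftQ _ (LinearMap.toSpanSingleton R R s) fun a ha ↦ by simpa using hms a ha
      have hf : Function.Injective f := by
        rw [← LinearMap.ker_eq_bot]
        refine Submodule.ker_liftQ_eq_bot _ _ _ fun a ha ↦ ?_
        rw [IsLocalRing.mem_maximalIdeal, mem_nonunits_iff]
        intro hu
        exact hs (by simpa [hu.mul_right_eq_zero] using ha)
      let S := ModuleCat.shortComplexOfCompEqZero _ _ f.exact_map_mkQ_range.linearMap_comp_eq_zero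
      have hS : S.ShortExact := ModuleCat.shortComplex_shortExact S
          f.exact_map_mkQ_range hf (Submodule.mkQ_surjective _)
      have : Subsingleton (Ext S.X₃ (ModuleCat.of R R) (n + 1 + 1)) := h S.X₃ inferInstance
      have : Subsingleton (Ext S.X₂ (ModuleCat.of R R) (n + 1)) :=
        subsingleton_of_forall_eq 0 fun α ↦ α.eq_zero_of_projective
      exact ModuleCat.subsingleton_ext_X₁ hS _ _
    · exact subsingleton_ext_quotient_prime _ _ h p hp
  induction hM using IsNoetherianRing.induction_on_isQuotientEquivQuotientPrime R with
  | subsingleton N =>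
    refine subsingleton_of_forall_eq 0 fun α ↦ ?_
    have : Limits.IsZero (ModuleCat.of R N) := ModuleCat.isZero_of_subsingleton _
    rw [← α.mk₀_id_comp, this.eq_zero_of_src (𝟙 _), Ext.mk₀_zero, Ext.zero_comp]
  | quotient N p e =>
    have := key p.1
    refine subsingleton_of_forall_eq 0 fun α ↦ ?_
    rw [← α.mk₀_id_comp, ← e.toModuleIso.hom_inv_id, ← Ext.mk₀_comp_mk₀_assoc,
      Subsingleton.elim ((Ext.mk₀ e.toModuleIso.inv).comp α _) 0, Ext.comp_zero]
  | exact N₁ N₂ N₃ f g hf hg hfg h₁ h₃ =>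
    exact ModuleCat.subsingleton_ext_X₂ (ModuleCat.shortComplex_shortExact
      (ModuleCat.shortComplexOfCompEqZero f g hfg.linearMap_comp_eq_zero) hfg hf hg) _ _

/-- If `R` has nonzero socle and finite injective dimension, then `Ext^1(-, R)` vanishes on finite
modules. -/
theorem subsingleton_ext_one_of_socle {s : R} (hs : s ≠ 0)
    (hms : ∀ a ∈ maximalIdeal R, a * s = 0)
    (n : ℕ) [HasInjectiveDimensionLT (ModuleCat.of R R) n]
    (M : ModuleCat.{u} R) (hM : Module.Finite R M) :
    Subsingleton (Ext M (ModuleCat.of R R) 1) := by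
  have H : ∀ M : ModuleCat.{u} R, Module.Finite R M →
      Subsingleton (Ext M (ModuleCat.of R R) (n + 1)) := fun M _ ↦
    HasInjectiveDimensionLT.subsingleton _ n _ n.le_succ M
  induction n with
  | zero => exact H M hM
  | succ n ih => exact ih (subsingleton_ext_of_socle hs hms n H)

/-- If `R` has finite injective dimension over itself, a nonzero socle element lies in every nonzero
ideal. -/
theorem mem_of_socle {s : R} (hs : s ≠ 0) (hms : ∀ a ∈ maximalIdeal R, a * s = 0)
    (n : ℕ) [HasInjectiveDimensionLT (ModuleCat.of R R) n] {I : Ideal R} (hI : I ≠ ⊥) :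
    s ∈ I := by
  by_contra hsI
  have hdisj : Disjoint I (Ideal.span {s}) := by
    rw [Submodule.disjoint_def]
    intro y hyI hy
    obtain ⟨a, rfl⟩ := Ideal.mem_span_singleton'.1 hy
    by_cases ha : a ∈ maximalIdeal R
    · exact hms a ha
    · rw [IsLocalRing.mem_maximalIdeal, mem_nonunits_iff, not_not] at ha
      exact absurd ((Ideal.unit_mul_mem_iff_mem I ha).1 hyI) hsI
  let g₁ : R →ₗ.[R] R := ⟨I, I.subtype⟩
  let g₂ : R →ₗ.[R] R := ⟨Ideal.span {s}, 0⟩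
  have hg : ∀ (a : g₁.domain) (b : g₂.domain), (a : R) = b → g₁ a = g₂ b := fun a b hab ↦
    Submodule.disjoint_def.1 hdisj a a.2 (hab ▸ b.2)
  obtain ⟨c, hc⟩ := exists_mul_eq_of_subsingleton_ext
    (subsingleton_ext_one_of_socle hs hms n (ModuleCat.of R (R ⧸ (g₁.sup g₂ hg).domain))
      inferInstance) (g₁.sup g₂ hg).toFun
  have hc₁ (i : R) (hi : i ∈ I) : i = c * i :=
    ((LinearPMap.left_le_sup g₁ g₂ hg).2 (x := ⟨i, hi⟩)
      (y := ⟨i, Submodule.mem_sup_left hi⟩) rfl).trans (hc _)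
  have hs' : s ∈ Ideal.span {s} := Ideal.mem_span_singleton_self s
  have hc₂ : 0 = c * s :=
    ((LinearPMap.right_le_sup g₁ g₂ hg).2 (x := ⟨s, hs'⟩)
      (y := ⟨s, Submodule.mem_sup_right hs'⟩) rfl).trans (hc _)
  have hcu : ¬ IsUnit c := fun hu ↦ hs (hu.mul_right_eq_zero.1 hc₂.symm)
  have hu : IsUnit (1 - c) := (IsLocalRing.isUnit_or_isUnit_one_sub_self c).resolve_left hcu
  refine hI ((Submodule.eq_bot_iff _).2 fun i hi ↦ hu.mul_right_eq_zero.1 ?_)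
  rw [sub_mul, one_mul, ← hc₁ i hi, sub_self]

end

section

variable {R : Type u} [CommRing R] (y : R)

open Submodule

/-- The map induced on `y`-torsion submodules by a linear map, as a map of `R ⧸ (y)`-modules. -/
def torsionByMap {M N : Type*} [AddCommGroup M] [Module R M] [AddCommGroup N] [Module R N]
    (f : M →ₗ[R] N) : torsionBy R M y →ₗ[R ⧸ Ideal.span {y}] torsionBy R N y where
  toFun m := ⟨f m, by rw [mem_torsionBy_iff, ← map_smul, smul_coe_torsionBy, map_zero]⟩
  map_add' m m' := Subtype.ext (map_add f (m : M) m')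
  map_smul' c m := by
    obtain ⟨r, rfl⟩ := Ideal.Quotient.mk_surjective c
    exact Subtype.ext (map_smul f r (m : M))

/-- The `y`-torsion of an injective `R`-module is an injective `R ⧸ (y)`-module. -/
theorem injective_torsionBy (E : Type u) [AddCommGroup E] [Module R E]
    (hE : Module.Injective R E) :
    Module.Injective (R ⧸ Ideal.span {y}) (torsionBy R E y) := by
  refine Module.Baer.injective fun I g ↦ ?_
  let g₁ : I.comap (Ideal.Quotient.mk (Ideal.span {y})) →ₗ[R] E :=
    { toFun := fun r ↦ (g ⟨Ideal.Quotient.mk _ r, r.2⟩ : E)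
      map_add' := fun r r' ↦ congrArg Subtype.val
        (g.map_add ⟨Ideal.Quotient.mk _ r, r.2⟩ ⟨Ideal.Quotient.mk _ r', r'.2⟩)
      map_smul' := fun c r ↦ congrArg Subtype.val
        (g.map_smul (Ideal.Quotient.mk _ c) ⟨Ideal.Quotient.mk _ r, r.2⟩) }
  obtain ⟨h, hh⟩ := Module.Baer.of_injective hE _ g₁
  have hy : h 1 ∈ torsionBy R E y := by
    have hy0 : Ideal.Quotient.mk (Ideal.span {y}) y = 0 :=
      Ideal.Quotient.eq_zero_iff_mem.2 (Ideal.mem_span_singleton_self y)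
    have hyI : y ∈ I.comap (Ideal.Quotient.mk (Ideal.span {y})) := by
      rw [Ideal.mem_comap, hy0]; exact I.zero_mem
    rw [mem_torsionBy_iff, ← map_smul, smul_eq_mul, mul_one, hh y hyI]
    have : (⟨Ideal.Quotient.mk _ y, hyI⟩ : I) = 0 := Subtype.ext hy0
    change ((g ⟨Ideal.Quotient.mk _ y, hyI⟩ : torsionBy R E y) : E) = 0
    rw [this, map_zero]; rfl
  refine ⟨LinearMap.toSpanSingleton _ _ ⟨h 1, hy⟩, fun c hc ↦ ?_⟩
  obtain ⟨r, rfl⟩ := Ideal.Quotient.mk_surjective c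
  refine Subtype.ext ?_
  refine Eq.trans ?_ (hh r hc)
  change r • h 1 = h r
  rw [← map_smul, smul_eq_mul, mul_one]

variable {y}

/-- An injective module is divisible by every nonzerodivisor. -/
theorem exists_smul_eq_of_injective (hy : IsSMulRegular R y) {E : Type u} [AddCommGroup E]
    [Module R E] (hE : Module.Injective R E) (e : E) : ∃ e', y • e' = e := by
  obtain ⟨h, hh⟩ := hE.out (LinearMap.lsmul R R y) hy (LinearMap.toSpanSingleton R E e)
  refine ⟨h 1, ?_⟩
  rw [← map_smul]
  simpa using hh 1

/-- Passing to `y`-torsion does not raise the injective dimension of a `y`-divisible module. -/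
theorem hasInjectiveDimensionLT_torsionBy (hy : IsSMulRegular R y) (n : ℕ) :
    ∀ (N : Type u) [AddCommGroup N] [Module R N] (_ : ∀ a : N, ∃ a', y • a' = a)
      [HasInjectiveDimensionLT (ModuleCat.of R N) (n + 1)],
      HasInjectiveDimensionLT (ModuleCat.of (R ⧸ Ideal.span {y}) (torsionBy R N y)) (n + 1) := by
  induction n with
  | zero =>
    intro N _ _ hN hd
    have : Injective (ModuleCat.of R N) := injective_iff_hasInjectiveDimensionLT_one.2 hd
    have hi := injective_torsionBy y N (Module.injective_module_of_injective_object R N)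
    have := Module.injective_object_of_injective_module (R ⧸ Ideal.span {y}) (torsionBy R N y)
    exact injective_iff_hasInjectiveDimensionLT_one.1 this
  | succ n ih =>
    intro N _ _ hN hd
    let ⟨E, _, f, _⟩ := EnoughInjectives.presentation (ModuleCat.of R N)
    have hE : Module.Injective R E := Module.injective_module_of_injective_object R E
    have hf : Function.Injective f.hom := (ModuleCat.mono_iff_injective f).mp ‹_›
    let Q : Type u := E ⧸ f.hom.range
    let π : E →ₗ[R] Q := f.hom.range.mkQ
    have hπ : Function.Surjective π := Submodule.mkQ_surjective _
    let S := ModuleCat.shortComplexOfCompEqZero _ _ f.hom.exact_map_mkQ_range.linearMap_comp_eq_zero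
    have hS : S.ShortExact := ModuleCat.shortComplex_shortExact S
      f.hom.exact_map_mkQ_range hf (Submodule.mkQ_surjective _)
    have hQ : HasInjectiveDimensionLT (ModuleCat.of R Q) (n + 1) :=
      (hS.hasInjectiveDimensionLT_X₃_iff n inferInstance).2 hd
    have hQdiv (q : Q) : ∃ q', y • q' = q := by
      obtain ⟨e, rfl⟩ := hπ q
      obtain ⟨e', rfl⟩ := exists_smul_eq_of_injective hy hE e
      exact ⟨π e', (map_smul _ _ _).symm⟩
    have hQ' := ih Q hQdiv
    have hex : Function.Exact (torsionByMap y f.hom) (torsionByMap y π) := by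
      intro e
      constructor
      · intro he
        have he' : (e : E) ∈ f.hom.range := by
          rw [← Submodule.Quotient.mk_eq_zero]
          exact congrArg Subtype.val he
        obtain ⟨a, ha⟩ := he'
        refine ⟨⟨a, ?_⟩, Subtype.ext ha⟩
        rw [mem_torsionBy_iff]
        apply hf
        rw [map_smul, ha, smul_coe_torsionBy, map_zero]
      · rintro ⟨a, rfl⟩
        exact Subtype.ext ((Submodule.Quotient.mk_eq_zero _).2 ⟨a, rfl⟩)
    have hinj : Function.Injective (torsionByMap y f.hom) := fun a b hab ↦
      Subtype.ext (hf (congrArg Subtype.val hab))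
    have hsurj : Function.Surjective (torsionByMap y π) := by
      rintro ⟨q, hq⟩
      obtain ⟨e, rfl⟩ := hπ q
      rw [mem_torsionBy_iff, ← map_smul] at hq
      obtain ⟨a, ha⟩ := (Submodule.Quotient.mk_eq_zero _).1 hq
      obtain ⟨a', rfl⟩ := hN a
      refine ⟨⟨e - f.hom a', ?_⟩, Subtype.ext ?_⟩
      · rw [mem_torsionBy_iff, smul_sub, ← ha, map_smul, sub_self]
      · change π (e - f.hom a') = π e
        rw [map_sub, sub_eq_self]
        exact (Submodule.Quotient.mk_eq_zero _).2 ⟨a', rfl⟩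
    have hT := ModuleCat.shortComplex_shortExact
      (ModuleCat.shortComplexOfCompEqZero _ _ hex.linearMap_comp_eq_zero) hex hinj hsurj
    have hEi := injective_torsionBy y E hE
    have := Module.injective_object_of_injective_module (R ⧸ Ideal.span {y}) (torsionBy R E y)
    exact (hT.hasInjectiveDimensionLT_X₃_iff n this).1 hQ'

/-- Finite injective dimension of `R` over itself passes to the quotient by a nonzerodivisor. -/
theorem hasInjectiveDimensionLT_quotient (hy : IsSMulRegular R y) (n : ℕ)
    [HasInjectiveDimensionLT (ModuleCat.of R R) n] :
    HasInjectiveDimensionLT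
      (ModuleCat.of (R ⧸ Ideal.span {y}) (R ⧸ Ideal.span {y})) (n + 1) := by
  let ⟨E, _, f, _⟩ := EnoughInjectives.presentation (ModuleCat.of R R)
  have hE : Module.Injective R E := Module.injective_module_of_injective_object R E
  have hf : Function.Injective f.hom := (ModuleCat.mono_iff_injective f).mp ‹_›
  let Q : Type u := E ⧸ f.hom.range
  let π : E →ₗ[R] Q := f.hom.range.mkQ
  have hπ : Function.Surjective π := Submodule.mkQ_surjective _
  have hπ0 (e : E) : π e = 0 ↔ ∃ r, f.hom r = e := Submodule.Quotient.mk_eq_zero _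
  let S := ModuleCat.shortComplexOfCompEqZero _ _ f.hom.exact_map_mkQ_range.linearMap_comp_eq_zero
  have hS : S.ShortExact := ModuleCat.shortComplex_shortExact S
    f.hom.exact_map_mkQ_range hf (Submodule.mkQ_surjective _)
  have hQ : HasInjectiveDimensionLT (ModuleCat.of R Q) (n + 1) :=
    (hS.hasInjectiveDimensionLT_X₃_iff n inferInstance).2
      (hasInjectiveDimensionLT_of_ge (ModuleCat.of R R) n _ (by lia))
  have hQdiv (q : Q) : ∃ q', y • q' = q := by
    obtain ⟨e, rfl⟩ := hπ q
    obtain ⟨e', rfl⟩ := exists_smul_eq_of_injective hy hE e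
    exact ⟨π e', (map_smul _ _ _).symm⟩
  have hQ' := hasInjectiveDimensionLT_torsionBy hy n Q hQdiv
  have hEi := injective_torsionBy y E hE
  have hEi' := Module.injective_object_of_injective_module (R ⧸ Ideal.span {y}) (torsionBy R E y)
  let φ := torsionByMap y π
  have hφ : Function.Injective φ := by
    rw [← LinearMap.ker_eq_bot, LinearMap.ker_eq_bot']
    intro e he
    obtain ⟨r, hr⟩ := (hπ0 e).1 (congrArg Subtype.val he)
    have : y • r = 0 := hf (by rw [map_smul, hr, smul_coe_torsionBy, map_zero])
    have hr0 : r = 0 := hy (by simpa using this)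
    exact Subtype.ext (by rw [← hr, hr0, map_zero]; rfl)
  obtain ⟨e₀, he₀⟩ := exists_smul_eq_of_injective hy hE (f.hom (1 : R))
  have hr₀ (r : R) : y • r • e₀ = f.hom r := by
    rw [smul_comm, he₀, ← map_smul, smul_eq_mul, mul_one]
  have hq₀ : π e₀ ∈ torsionBy R Q y := by
    rw [mem_torsionBy_iff, ← map_smul, he₀, hπ0]; exact ⟨_, rfl⟩
  let ψ : (R ⧸ Ideal.span {y}) →ₗ[R ⧸ Ideal.span {y}] (torsionBy R Q y ⧸ φ.range) :=
    φ.range.mkQ ∘ₗ LinearMap.toSpanSingleton _ _ ⟨π e₀, hq₀⟩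
  have hψ : Function.Bijective ψ := by
    constructor
    · rw [← LinearMap.ker_eq_bot, LinearMap.ker_eq_bot']
      intro c hc
      obtain ⟨r, rfl⟩ := Ideal.Quotient.mk_surjective c
      obtain ⟨e, he⟩ := (Submodule.Quotient.mk_eq_zero _).1 hc
      have he' : π e = π (r • e₀) := congrArg Subtype.val he
      rw [← sub_eq_zero, ← map_sub, hπ0] at he'
      obtain ⟨t, ht⟩ := he'
      have hyt : y • t = -r := hf (by
        rw [map_smul, ht, smul_sub, smul_coe_torsionBy, hr₀, zero_sub, map_neg])
      rw [Ideal.Quotient.eq_zero_iff_mem, Ideal.mem_span_singleton]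
      exact ⟨-t, by rw [mul_neg, ← smul_eq_mul, hyt, neg_neg]⟩
    · intro q
      obtain ⟨⟨q, hq⟩, rfl⟩ := φ.range.mkQ_surjective q
      obtain ⟨e, rfl⟩ := hπ q
      rw [mem_torsionBy_iff, ← map_smul, hπ0] at hq
      obtain ⟨r, hr⟩ := hq
      refine ⟨Ideal.Quotient.mk _ r, ?_⟩
      refine (Submodule.Quotient.eq _).2 ⟨⟨r • e₀ - e, ?_⟩, Subtype.ext ?_⟩
      · rw [mem_torsionBy_iff, smul_sub, hr₀, hr, sub_self]
      · exact map_sub π (r • e₀) e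
  let T := ModuleCat.shortComplexOfCompEqZero _ _ φ.exact_map_mkQ_range.linearMap_comp_eq_zero
  have hT : T.ShortExact := ModuleCat.shortComplex_shortExact T
    φ.exact_map_mkQ_range hφ (Submodule.mkQ_surjective _)
  have hT1 : Injective T.X₁ := hEi'
  have hX₃ : HasInjectiveDimensionLT T.X₃ (n + 1) :=
    hT.hasInjectiveDimensionLT_X₃ (n + 1) hQ' (hasInjectiveDimensionLT_of_ge T.X₁ 1 _ (by lia))
  exact hasInjectiveDimensionLT_of_iso (LinearEquiv.ofBijective ψ hψ).toModuleIso.symm (n + 1)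

end

section

variable {R : Type u} [CommRing R] [IsLocalRing R]

/-- A local ring with nilpotent maximal ideal has a nonzero socle element. -/
theorem exists_socle_of_isNilpotent (h : IsNilpotent (maximalIdeal R)) :
    ∃ s : R, s ≠ 0 ∧ ∀ a ∈ maximalIdeal R, a * s = 0 := by
  classical
  obtain ⟨k, hk, hk'⟩ : ∃ k, maximalIdeal R ^ (k + 1) = ⊥ ∧ maximalIdeal R ^ k ≠ ⊥ := by
    have h0 : Nat.find h ≠ 0 := fun h0 ↦ by
      have := Nat.find_spec h
      rw [h0, pow_zero] at this
      exact one_ne_zero this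
    obtain ⟨k, hk⟩ := Nat.exists_eq_succ_of_ne_zero h0
    exact ⟨k, by simpa [hk] using Nat.find_spec h, Nat.find_min h (hk ▸ k.lt_succ_self)⟩
  obtain ⟨s, hs, hs0⟩ := Submodule.exists_mem_ne_zero_of_ne_bot hk'
  refine ⟨s, hs0, fun a ha ↦ ?_⟩
  have := Ideal.mul_mem_mul hs ha
  rwa [← pow_succ, hk, Ideal.mem_bot, mul_comm] at this

/-- An element of a finitely generated ideal `J` outside `m * J` can replace one of the generators. -/
theorem exists_span_range_eq_sup_of_notMem {d : ℕ} (x : Fin (d + 1) → R) {y : R}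
    (hy : y ∈ Ideal.span (Set.range x))
    (hy' : y ∉ maximalIdeal R * Ideal.span (Set.range x)) :
    ∃ i, Ideal.span (Set.range x) =
      Ideal.span {y} ⊔ Ideal.span (Set.range (x ∘ Fin.succAbove i)) := by
  obtain ⟨c, rfl⟩ := Ideal.mem_span_range_iff_exists_fun.1 hy
  obtain ⟨i, hi⟩ : ∃ i, IsUnit (c i) := by
    by_contra! hc
    exact hy' (Ideal.sum_mem _ fun i _ ↦ Ideal.mul_mem_mul (hc i)
      (Ideal.subset_span (Set.mem_range_self i)))
  have hsub : Ideal.span (Set.range (x ∘ Fin.succAbove i)) ≤ Ideal.span (Set.range x) :=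
    Ideal.span_mono (Set.range_comp_subset_range _ _)
  refine ⟨i, le_antisymm ?_ (sup_le ((Ideal.span_singleton_le_iff_mem _).2 hy) hsub)⟩
  have hj (j) : x (i.succAbove j) ∈ Ideal.span (Set.range (x ∘ Fin.succAbove i)) :=
    Ideal.subset_span ⟨j, rfl⟩
  rw [Ideal.span_le]
  rintro _ ⟨j, rfl⟩
  obtain rfl | ⟨j, rfl⟩ := Fin.eq_self_or_eq_succAbove i j
  · rw [SetLike.mem_coe, ← Ideal.unit_mul_mem_iff_mem _ hi]
    have h := Fin.sum_univ_succAbove (fun l ↦ c l * x l) j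
    rw [← sub_eq_iff_eq_add] at h
    rw [← h]
    exact sub_mem (Ideal.mem_sup_left (Ideal.mem_span_singleton_self _))
      (Ideal.mem_sup_right (Ideal.sum_mem _ fun l _ ↦ Ideal.mul_mem_left _ _ (hj l)))
  · exact Ideal.mem_sup_right (hj j)

variable [IsNoetherianRing R]

/-- If `m` is not an associated prime of `R`, every nonzero ideal `J` containing a power of `m`
contains a nonzerodivisor outside `m * J`. -/
theorem exists_isSMulRegular_notMem_mul (hm : maximalIdeal R ∉ associatedPrimes R R) {J : Ideal R}
    (hJ : J ≠ ⊥) (hJm : ∃ k, maximalIdeal R ^ k ≤ J) :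
    ∃ y ∈ J, IsSMulRegular R y ∧ y ∉ maximalIdeal R * J := by
  classical
  obtain ⟨k, hk⟩ := hJm
  by_contra! hc
  let s : Finset (Ideal R) :=
    insert (maximalIdeal R * J) (associatedPrimes.finite R R).toFinset
  have hs : (J : Set R) ⊆ ⋃ p ∈ (s : Set (Ideal R)), (p : Set R) := by
    intro y hy
    by_cases hreg : y ∈ nonZeroDivisors R
    · refine Set.mem_biUnion (x := maximalIdeal R * J) (by simp [s]) (hc y hy ?_)
      exact (isRegular_iff_mem_nonZeroDivisors.2 hreg).left.isSMulRegular
    · have : y ∈ ⋃ p ∈ associatedPrimes R R, (p : Set R) := by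
        rw [biUnion_associatedPrimes_eq_compl_nonZeroDivisors]; exact hreg
      obtain ⟨p, hp, hyp⟩ := Set.mem_iUnion₂.1 this
      exact Set.mem_biUnion (x := p) (by simp [s, hp]) hyp
  obtain ⟨p, hp, hJp⟩ := (Ideal.subset_union_prime (f := fun p : Ideal R ↦ p)
    (maximalIdeal R * J) (maximalIdeal R * J) (fun p hp hne _ ↦ by
      simp only [s, Finset.mem_insert, hne, false_or, Set.Finite.mem_toFinset] at hp
      exact hp.isPrime)).1 hs
  simp only [s, Finset.mem_insert, Set.Finite.mem_toFinset] at hp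
  obtain rfl | hp := hp
  · exact hJ (Submodule.eq_bot_of_le_smul_of_le_jacobson_bot _ _ (IsNoetherian.noetherian J) hJp
      (maximalIdeal_le_jacobson _))
  · have := hp.isPrime
    refine hm (le_antisymm (le_maximalIdeal this.ne_top)
      (this.le_of_pow_le (hk.trans hJp)) ▸ hp)

/-- If `R` has finite injective dimension over itself and depth zero, then its maximal ideal is
nilpotent. -/
theorem isNilpotent_maximalIdeal_of_mem_associatedPrimes (n : ℕ)
    [CategoryTheory.HasInjectiveDimensionLT (ModuleCat.of R R) n]
    (hm : maximalIdeal R ∈ associatedPrimes R R) : IsNilpotent (maximalIdeal R) := by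
  obtain ⟨-, s, hs⟩ := isAssociatedPrime_iff.1 hm
  have hs0 : s ≠ 0 := by
    rintro rfl
    apply (maximalIdeal.isMaximal R).ne_top
    rw [hs]; ext; simp [Submodule.mem_colon_singleton]
  have hms (a) (ha : a ∈ maximalIdeal R) : a * s = 0 := by
    rw [hs] at ha; simpa [Submodule.mem_colon_singleton] using ha
  by_contra hnil
  refine hs0 ?_
  rw [← Ideal.mem_bot, ← Ideal.iInf_pow_eq_bot_of_isLocalRing _ (maximalIdeal.isMaximal R).ne_top,
    Ideal.mem_iInf]
  exact fun k ↦ mem_of_socle hs0 hms n fun h ↦ hnil ⟨k, h⟩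

theorem ringKrullDim_eq_zero_of_isNilpotent_maximalIdeal (h : IsNilpotent (maximalIdeal R)) :
    ringKrullDim R = 0 := by
  rw [← ringKrullDimZero_iff_ringKrullDim_eq_zero, ← isArtinianRing_iff_krullDimLE_zero]
  exact (isArtinianRing_iff_isNilpotent_maximalIdeal R).2 h

end

/-- In a Noetherian local ring of finite injective dimension over itself, an ideal generated by a
system of parameters has a smallest strict overideal. -/
theorem IsSystemOfParameters.exists_minimal_overideal (d : ℕ) :
    ∀ (R : Type u) [CommRing R] [IsNoetherianRing R] [IsLocalRing R] (n : ℕ)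
      [CategoryTheory.HasInjectiveDimensionLT (ModuleCat.of R R) n] (x : Fin d → R),
      IsSystemOfParameters R x →
      ∃ J₁ : Ideal R, Ideal.span (Set.range x) < J₁ ∧
        ∀ J₂ : Ideal R, Ideal.span (Set.range x) < J₂ → J₁ ≤ J₂ := by
  induction d with
  | zero =>
    rintro R _ _ _ n _ x ⟨-, -, k, hk⟩
    have hbot : Ideal.span (Set.range x) = ⊥ := by simp
    rw [hbot] at hk ⊢
    obtain ⟨s, hs, hms⟩ := exists_socle_of_isNilpotent ⟨k, le_bot_iff.1 hk⟩
    refine ⟨Ideal.span {s}, bot_lt_iff_ne_bot.2 (by simpa using hs), fun J₂ hJ₂ ↦ ?_⟩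
    exact (Ideal.span_singleton_le_iff_mem _).2 (mem_of_socle hs hms n hJ₂.ne')
  | succ d ih =>
    rintro R _ _ _ n _ x ⟨hd, hx, k, hk⟩
    have hnil : ¬ IsNilpotent (maximalIdeal R) := fun h ↦ by
      rw [ringKrullDim_eq_zero_of_isNilpotent_maximalIdeal h] at hd
      exact absurd (by exact_mod_cast hd) d.succ_ne_zero.symm
    obtain ⟨y, hyJ, hreg, hymJ⟩ := exists_isSMulRegular_notMem_mul
      (fun h ↦ hnil (isNilpotent_maximalIdeal_of_mem_associatedPrimes n h))
      (fun h ↦ hnil ⟨k, le_bot_iff.1 (h ▸ hk)⟩) ⟨k, hk⟩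
    obtain ⟨i, hi⟩ := exists_span_range_eq_sup_of_notMem x hyJ hymJ
    have hJm : Ideal.span (Set.range x) ≤ maximalIdeal R :=
      Ideal.span_le.2 (Set.range_subset_iff.2 hx)
    let π := Ideal.Quotient.mk (Ideal.span {y})
    have hπ : Function.Surjective π := Ideal.Quotient.mk_surjective
    have hker : RingHom.ker π ≤ Ideal.span (Set.range x) := by
      rw [Ideal.mk_ker]; exact (Ideal.span_singleton_le_iff_mem _).2 hyJ
    have : Nontrivial (R ⧸ Ideal.span {y}) := Ideal.Quotient.nontrivial_iff.2 fun h ↦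
      (maximalIdeal.isMaximal R).ne_top
        (top_le_iff.1 (h ▸ (Ideal.span_singleton_le_iff_mem _).2 (hJm hyJ)))
    have hloc : IsLocalRing (R ⧸ Ideal.span {y}) := .of_surjective' π hπ
    have hmap : (Ideal.span (Set.range x)).map π =
        Ideal.span (Set.range (π ∘ x ∘ Fin.succAbove i)) := by
      rw [hi, Ideal.map_sup, Ideal.map_span, Ideal.map_span, ← Set.range_comp, Set.image_singleton,
        Ideal.Quotient.eq_zero_iff_mem.2 (Ideal.mem_span_singleton_self y)]
      simp
    have hcm (I : Ideal R) (hI : Ideal.span (Set.range x) ≤ I) : (I.map π).comap π = I := by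
      rw [Ideal.comap_map_of_surjective' π hπ, sup_eq_left.2 (hker.trans hI)]
    have hmax : (maximalIdeal R).map π = maximalIdeal (R ⧸ Ideal.span {y}) := by
      refine eq_maximalIdeal ((Ideal.map_eq_top_or_isMaximal_of_surjective π hπ
        (maximalIdeal.isMaximal R)).resolve_left fun h ↦ (maximalIdeal.isMaximal R).ne_top ?_)
      rw [← hcm _ hJm, h, Ideal.comap_top]
    have := hasInjectiveDimensionLT_quotient hreg n
    obtain ⟨J₁, hJ₁, hmin⟩ := ih (R ⧸ Ideal.span {y}) (n + 1) (π ∘ x ∘ Fin.succAbove i) (by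
      refine ⟨?_, fun j ↦ hmax ▸ Ideal.mem_map_of_mem π (hx _), k, ?_⟩
      · have h := ringKrullDim_quotient_span_singleton_succ_eq_ringKrullDim hreg (hJm hyJ)
        rw [hd] at h
        exact ENat.WithBot.add_one_cancel.1 (by exact_mod_cast h)
      · rw [← hmap, ← hmax, ← Ideal.map_pow]
        exact Ideal.map_mono hk)
    rw [← hmap] at hJ₁ hmin
    refine ⟨J₁.comap π, ?_, fun J₂ hJ₂ ↦ ?_⟩
    · rw [← hcm _ le_rfl]
      refine lt_of_le_of_ne (Ideal.comap_mono hJ₁.le) fun h ↦ hJ₁.ne ?_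
      exact Ideal.comap_injective_of_surjective π hπ h
    · rw [← hcm _ hJ₂.le]
      refine Ideal.comap_mono (hmin _ (lt_of_le_of_ne (Ideal.map_mono hJ₂.le) fun h ↦ hJ₂.ne ?_))
      rw [← hcm _ le_rfl, h, hcm _ hJ₂.le]

/-- If a Noetherian local ring has a smallest nonzero ideal, then its socle is simple. -/
theorem isSimpleModule_socle {A : Type*} [CommRing A] [IsLocalRing A] [IsNoetherianRing A]
    {I : Ideal A} (hI : I ≠ ⊥) (hmin : ∀ I₂ : Ideal A, I₂ ≠ ⊥ → I ≤ I₂) :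
    IsSimpleModule A ↥((⊥ : Ideal A).colon (maximalIdeal A)) := by
  have hmI : maximalIdeal A * I = ⊥ := by
    by_contra h
    exact hI (Submodule.eq_bot_of_le_smul_of_le_jacobson_bot _ _ (IsNoetherian.noetherian I)
      (hmin _ h) (maximalIdeal_le_jacobson _))
  have heq : (⊥ : Ideal A).colon (maximalIdeal A) = I := by
    apply le_antisymm
    · intro c hc
      by_cases hc0 : c = 0
      · exact hc0 ▸ I.zero_mem
      obtain ⟨b, hb, hb0⟩ := Submodule.exists_mem_ne_zero_of_ne_bot hI
      obtain ⟨a, rfl⟩ := Ideal.mem_span_singleton'.1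
        (hmin (Ideal.span {c}) (by simpa using hc0) hb)
      have ha : IsUnit a := by
        by_contra ha
        exact hb0 (by simpa [mul_comm] using Submodule.mem_colon.1 hc a ha)
      exact (Ideal.unit_mul_mem_iff_mem _ ha).1 hb
    · intro c hc
      refine Submodule.mem_colon.2 fun a ha ↦ ?_
      rw [← hmI, smul_eq_mul, mul_comm c a]
      exact Ideal.mul_mem_mul ha hc
  rw [heq, isSimpleModule_iff_isAtom]
  exact ⟨hI, fun I₂ h ↦ by_contra fun h0 ↦ h.not_ge (hmin I₂ h0)⟩

end

/-- In a Gorenstein local ring, an ideal `J` generated by a system of parameters has a unique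
minimal strict overideal; equivalently, the socle of `R/J` is a one-dimensional vector space
over the residue field, i.e. a simple module. -/
theorem parameter_ideal_unique_minimal_overideal
    (R : Type u) [CommRing R] [IsLocalRing R] (hgor : IsGorensteinLocalRing R)
    {d : ℕ} (x : Fin d → R) (hx : IsSystemOfParameters R x)
    (J : Ideal R) (hJ : J = Ideal.span (Set.range x)) [IsLocalRing (R ⧸ J)] :
    (∃ J₁ : Ideal R, J < J₁ ∧ ∀ J₂ : Ideal R, J < J₂ → J₁ ≤ J₂) ∧
    IsSimpleModule (R ⧸ J)
      ↥((⊥ : Ideal (R ⧸ J)).colon (maximalIdeal (R ⧸ J))) := by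
  subst hJ
  have := hgor.1
  obtain ⟨n, _⟩ := hgor.exists_hasInjectiveDimensionLT
  obtain ⟨J₁, hJ₁, hmin⟩ := hx.exists_minimal_overideal d R n x
  refine ⟨⟨J₁, hJ₁, hmin⟩, isSimpleModule_socle
    (I := J₁.map (Ideal.Quotient.mk (Ideal.span (Set.range x)))) ?_ fun I₂ hI₂ ↦ ?_⟩
  · rw [Ne, Ideal.map_eq_bot_iff_le_ker, Ideal.mk_ker]
    exact hJ₁.not_ge
  · rw [Ideal.map_le_iff_le_comap]
    refine hmin _ (lt_of_le_of_ne ?_ fun h ↦ hI₂ ?_)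
    · conv_lhs => rw [← Ideal.mk_ker (I := Ideal.span (Set.range x))]
      exact Ideal.comap_mono bot_le
    · rw [← Ideal.map_comap_of_surjective _ Ideal.Quotient.mk_surjective I₂, ← h,
        Ideal.map_quotient_self]
end
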